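/- Let $1<p<\infty$ and let $f\in L_p(\mathbb{T})$ be bounded and measurable. (i) If $\omega_2(f,1/n)_p=o\big(\|f_{1/(2n+1)}-f\|_{\ell_p(X_{2n+1}^L)}\big)$ as $n\to\infty$, then $\|f-L_n(f)\|_p$ and $\|f_{1/(2n+1)}-f\|_{\ell_p(X_{2n+1}^L)}$ have the same order as $n\to\infty$ (each bounded above by a constant multiple of the other for all large $n$). (ii) If $\|f_{1/(2n+1)}-f\|_{\ell_p(X_{2n+1}^L)}=o\big(\omega_2(f,1/n)_p\big)$ as $n\to\infty$, then $\|f-L_n(f)\|_p$ and $\omega_2(f,1/n)_p$ have the same order as $n\to\infty$. -/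

import Mathlib

open MeasureTheory Filter Finset

noncomputable def LpNorm (p : ℝ) (f : ℝ → ℝ) : ℝ :=
  (∫ x in (0:ℝ)..1, |f x| ^ p) ^ (1 / p)

def MemLpT (p : ℝ) (f : ℝ → ℝ) : Prop :=
  Function.Periodic f 1 ∧ Measurable f ∧
    IntervalIntegrable (fun x => |f x| ^ p) MeasureTheory.volume 0 1

noncomputable def Delta (r : ℕ) (h : ℝ) (f : ℝ → ℝ) (x : ℝ) : ℝ :=
  ∑ ν ∈ Finset.range (r + 1), ((-1 : ℝ) ^ ν * (r.choose ν : ℝ)) * f (x + ((r : ℝ) - (ν : ℝ)) * h)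

noncomputable def omegaMod (r : ℕ) (p : ℝ) (f : ℝ → ℝ) (δ : ℝ) : ℝ :=
  sSup {y | ∃ h : ℝ, 0 < h ∧ h < δ ∧ y = LpNorm p (Delta r h f)}

noncomputable def steklov (r : ℕ) (δ : ℝ) (f : ℝ → ℝ) (x : ℝ) : ℝ :=
  (-1 : ℝ) ^ (r + 1) * (((2 * r).choose r : ℝ))⁻¹ * (2 / δ) *
    ∫ t in (-(δ / 2))..(δ / 2),
      ∑ ν ∈ Finset.range r,
        (-1 : ℝ) ^ ν * (((2 * r).choose ν : ℝ)) * f (x + (((r : ℝ) - (ν : ℝ)) / (r : ℝ)) * t)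

noncomputable def ellp (p : ℝ) (n : ℕ) (x : ℕ → ℝ) (f : ℝ → ℝ) : ℝ :=
  ((1 / (n : ℝ)) * ∑ k ∈ Finset.range n, |f (x k)| ^ p) ^ (1 / p)

def SobolevW (s : ℕ) (g : ℝ → ℝ) : Prop :=
  Function.Periodic g 1 ∧ ContDiff ℝ (s : ℕ∞) g

noncomputable def localMod (r : ℕ) (f : ℝ → ℝ) (x δ : ℝ) : ℝ :=
  sSup {y | ∃ t h : ℝ, t ∈ Set.Icc (x - r * δ / 2) (x + r * δ / 2) ∧
    (t + r * h) ∈ Set.Icc (x - r * δ / 2) (x + r * δ / 2) ∧ y = |Delta r h f t|}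

noncomputable def tauMod (r : ℕ) (p : ℝ) (f : ℝ → ℝ) (δ : ℝ) : ℝ :=
  (∫ x in (0:ℝ)..1, localMod r f x δ ^ p) ^ (1 / p)

def IsTrigPoly (n : ℕ) (T : ℝ → ℝ) : Prop :=
  ∃ c : ℤ → ℂ, ∀ x : ℝ, (T x : ℂ) =
    ∑ ℓ ∈ Finset.Icc (-(n : ℤ)) (n : ℤ),
      c ℓ * Complex.exp (2 * Real.pi * Complex.I * (ℓ : ℂ) * (x : ℂ))

noncomputable def tildeE (n : ℕ) (p : ℝ) (f : ℝ → ℝ) : ℝ :=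
  sInf {y | ∃ Q q : ℝ → ℝ, IsTrigPoly n Q ∧ IsTrigPoly n q ∧
    (∀ x, q x ≤ f x ∧ f x ≤ Q x) ∧ y = LpNorm p (fun x => Q x - q x)}

noncomputable def dirichlet (n : ℕ) (x : ℝ) : ℝ :=
  ∑ ℓ ∈ Finset.Icc (-(n : ℤ)) (n : ℤ), Real.cos (2 * Real.pi * (ℓ : ℝ) * x)

noncomputable def lagrange (n : ℕ) (f : ℝ → ℝ) (x : ℝ) : ℝ :=
  (1 / (2 * (n : ℝ) + 1)) * ∑ k ∈ Finset.range (2 * n + 1),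
    f ((k : ℝ) / (2 * (n : ℝ) + 1)) * dirichlet n (x - (k : ℝ) / (2 * (n : ℝ) + 1))

def NodesOK (γ : ℝ) (X : ℕ → ℕ → ℝ) : Prop :=
  ∀ n : ℕ, 1 ≤ n →
    (0 ≤ X n 0) ∧ (∀ k, k + 1 < n → X n k < X n (k + 1)) ∧ (X n (n - 1) < 1) ∧
    (∀ k, k + 1 < n → γ / (n : ℝ) ≤ X n (k + 1) - X n k) ∧
    (γ / (n : ℝ) ≤ 1 + X n 0 - X n (n - 1))

def NodesOrd (X : ℕ → ℕ → ℝ) : Prop :=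
  ∀ n : ℕ, 1 ≤ n →
    (0 ≤ X n 0) ∧ (∀ k, k + 1 < n → X n k < X n (k + 1)) ∧ (X n (n - 1) < 1)

def SamplingForm (p : ℝ) (X : ℕ → ℕ → ℝ) (φ : ℕ → ℕ → ℝ → ℝ)
    (G : ℕ → (ℝ → ℝ) → ℝ → ℝ) : Prop :=
  (∀ n k, MemLpT p (φ n k)) ∧
  ∀ (n : ℕ) (f : ℝ → ℝ) (x : ℝ), G n f x = ∑ k ∈ Finset.range n, f (X n k) * φ n k x

def CondC1 (p K1 : ℝ) (X : ℕ → ℕ → ℝ) (G : ℕ → (ℝ → ℝ) → ℝ → ℝ) : Prop :=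
  ∀ f : ℝ → ℝ, MemLpT p f → ∀ n : ℕ, 1 ≤ n → LpNorm p (G n f) ≤ K1 * ellp p n (X n) f

def CondC1' (p K2 : ℝ) (X : ℕ → ℕ → ℝ) (G : ℕ → (ℝ → ℝ) → ℝ → ℝ) : Prop :=
  ∀ f : ℝ → ℝ, MemLpT p f → ∀ n : ℕ, 1 ≤ n → K2 * ellp p n (X n) f ≤ LpNorm p (G n f)

def CondC2' (p K3 : ℝ) (s : ℕ) (G : ℕ → (ℝ → ℝ) → ℝ → ℝ) : Prop :=
  ∀ g : ℝ → ℝ, SobolevW s g → ∀ n : ℕ, 1 ≤ n →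
    LpNorm p (fun x => g x - G n g x) ≤ K3 / (n : ℝ) ^ s * LpNorm p (iteratedDeriv s g)

def CondC3 (p K5 : ℝ) (s : ℕ) (G : ℕ → (ℝ → ℝ) → ℝ → ℝ) : Prop :=
  ∀ f : ℝ → ℝ, MemLpT p f → ∀ n : ℕ, 1 ≤ n →
    SobolevW s (G n f) ∧
    (1 / (n : ℝ) ^ s) * LpNorm p (iteratedDeriv s (G n f)) ≤
      K5 * omegaMod s p (G n f) (1 / (n : ℝ))

noncomputable def Gprev (G : ℕ → (ℝ → ℝ) → ℝ → ℝ) (f : ℝ → ℝ) (ν : ℕ) : ℝ → ℝ :=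
  if ν = 0 then fun _ => 0 else G (2 ^ (ν - 1)) f

def CondC4 (p K4 : ℝ) (s : ℕ) (G : ℕ → (ℝ → ℝ) → ℝ → ℝ) (f : ℝ → ℝ) : Prop :=
  ∀ ν : ℕ,
    SobolevW s (fun x => G (2 ^ ν) f x - Gprev G f ν x) ∧
    LpNorm p (iteratedDeriv s (fun x => G (2 ^ ν) f x - Gprev G f ν x)) ≤
      K4 * 2 ^ (s * ν) * LpNorm p (fun x => G (2 ^ ν) f x - Gprev G f ν x)

noncomputable def Kfun (s : ℕ) (p : ℝ) (n : ℕ) (x : ℕ → ℝ) (f : ℝ → ℝ) : ℝ :=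
  sInf {y | ∃ g : ℝ → ℝ, SobolevW s g ∧
    y = ellp p n x (fun t => f t - g t) + LpNorm p (fun t => f t - g t) +
        (1 / (n : ℝ) ^ s) * LpNorm p (iteratedDeriv s g)}


namespace MZ
open Complex in
noncomputable def e (l : ℤ) (x : ℝ) : ℂ := Complex.exp (2 * Real.pi * Complex.I * l * x)

lemma e_add (l m : ℤ) (x : ℝ) : e (l + m) x = e l x * e m x := by
  unfold e; rw [← Complex.exp_add]; congr 1; push_cast; ring

lemma e_add_arg (l : ℤ) (x y : ℝ) : e l (x + y) = e l x * e l y := by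
  unfold e; rw [← Complex.exp_add]; congr 1; push_cast; ring

lemma e_zero (x : ℝ) : e 0 x = 1 := by simp [e]
lemma e_zero_arg (l : ℤ) : e l 0 = 1 := by simp [e]

lemma e_int (l m : ℤ) : e l (m : ℝ) = 1 := by
  unfold e; rw [Complex.exp_eq_one_iff]; exact ⟨l * m, by push_cast; ring⟩

lemma norm_e (l : ℤ) (x : ℝ) : ‖e l x‖ = 1 := by
  unfold e
  have : (2 * Real.pi * Complex.I * l * x : ℂ) = ((2 * Real.pi * l * x : ℝ) : ℂ) * Complex.I := by
    push_cast; ring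
  rw [this, Complex.norm_exp_ofReal_mul_I]

lemma conj_e (l : ℤ) (x : ℝ) : (starRingEnd ℂ) (e l x) = e (-l) x := by
  unfold e; rw [← Complex.exp_conj]; congr 1; simp [Complex.conj_ofNat]

lemma e_cos_sin (l : ℤ) (x : ℝ) : e l x = (Real.cos (2 * Real.pi * l * x) : ℂ) + (Real.sin (2 * Real.pi * l * x) : ℂ) * Complex.I := by
  unfold e
  have : (2 * Real.pi * Complex.I * l * x : ℂ) = ((2 * Real.pi * l * x : ℝ) : ℂ) * Complex.I := by
    push_cast; ring
  rw [this, Complex.exp_mul_I]; simp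

@[fun_prop]
lemma cont_e (l : ℤ) : Continuous (e l) := by
  unfold e; fun_prop

noncomputable def tp (c : ℤ →₀ ℂ) (x : ℝ) : ℂ := c.sum fun l a => a * e l x

@[fun_prop]
lemma cont_tp (c : ℤ →₀ ℂ) : Continuous (tp c) := by
  unfold tp Finsupp.sum; fun_prop

lemma tp_add (c d : ℤ →₀ ℂ) (x : ℝ) : tp (c + d) x = tp c x + tp d x := by
  unfold tp; exact Finsupp.sum_add_index' (by simp) (by intros; ring)

lemma tp_smul (a : ℂ) (c : ℤ →₀ ℂ) (x : ℝ) : tp (a • c) x = a * tp c x := by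
  unfold tp; rw [Finsupp.sum_smul_index' (by simp), Finsupp.mul_sum]
  simp [mul_assoc]

lemma tp_zero (x : ℝ) : tp 0 x = 0 := by simp [tp]

lemma tp_neg (c : ℤ →₀ ℂ) (x : ℝ) : tp (-c) x = - tp c x := by
  have := tp_smul (-1) c x; simpa using this

lemma tp_sub (c d : ℤ →₀ ℂ) (x : ℝ) : tp (c - d) x = tp c x - tp d x := by
  rw [sub_eq_add_neg, tp_add, tp_neg]; ring

lemma tp_sum {ι : Type*} (s : Finset ι) (c : ι → ℤ →₀ ℂ) (x : ℝ) :
    tp (∑ i ∈ s, c i) x = ∑ i ∈ s, tp (c i) x := by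
  classical
  induction s using Finset.induction_on with
  | empty => simp [tp_zero]
  | insert a s ha ih => rw [sum_insert ha, sum_insert ha, tp_add, ih]

lemma tp_single (l : ℤ) (a : ℂ) (x : ℝ) : tp (Finsupp.single l a) x = a * e l x := by
  simp [tp]

lemma e_per (l : ℤ) : Function.Periodic (e l) 1 := by
  intro x; rw [e_add_arg]; have := e_int l 1; simp at this; simp [this]

lemma tp_per (c : ℤ →₀ ℂ) : Function.Periodic (tp c) 1 := by
  intro x; unfold tp; simp only [(e_per _) x]

/-- multiplier -/
noncomputable def mul (m : ℤ → ℂ) (c : ℤ →₀ ℂ) : ℤ →₀ ℂ :=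
  Finsupp.onFinset c.support (fun l => m l * c l) (by intro l h; simp at h ⊢; tauto)

@[simp] lemma mul_apply (m : ℤ → ℂ) (c : ℤ →₀ ℂ) (l : ℤ) : mul m c l = m l * c l := rfl

lemma tp_mul (m : ℤ → ℂ) (c : ℤ →₀ ℂ) (x : ℝ) : tp (mul m c) x = c.sum fun l a => m l * a * e l x := by
  unfold tp mul; rw [Finsupp.onFinset_sum _ (by simp)]; rfl

lemma mul_mul (m k : ℤ → ℂ) (c : ℤ →₀ ℂ) : mul m (mul k c) = mul (fun l => m l * k l) c := by
  ext l; simp; ring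

lemma mul_add' (m : ℤ → ℂ) (c d : ℤ →₀ ℂ) : mul m (c + d) = mul m c + mul m d := by
  ext l; simp; ring
lemma mul_sub' (m : ℤ → ℂ) (c d : ℤ →₀ ℂ) : mul m (c - d) = mul m c - mul m d := by
  ext l; simp; ring
lemma mul_smul' (m : ℤ → ℂ) (a : ℂ) (c : ℤ →₀ ℂ) : mul m (a • c) = a • mul m c := by
  ext l; simp; ring

lemma mul_congr {m k : ℤ → ℂ} {c : ℤ →₀ ℂ} (h : ∀ l, c l ≠ 0 → m l = k l) : mul m c = mul k c := by
  ext l; by_cases hl : c l = 0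
  · simp [hl]
  · simp [h l hl]

/-- translation of a trigonometric polynomial as a multiplier -/
lemma tp_shift (c : ℤ →₀ ℂ) (x h : ℝ) : tp c (x + h) = tp (mul (fun l => e l h) c) x := by
  rw [tp_mul]; unfold tp; apply Finsupp.sum_congr; intro l _; rw [e_add_arg]; ring

structure BM (F : ℝ → ℂ) : Prop where
  meas : Measurable F
  bdd : ∃ M, ∀ x, ‖F x‖ ≤ M
  per : Function.Periodic F 1

lemma BM.of_cont {F : ℝ → ℂ} (hc : Continuous F) (hp : Function.Periodic F 1) : BM F := by
  refine ⟨hc.measurable, ?_, hp⟩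
  obtain ⟨M, hM⟩ := (isCompact_Icc (a := (0:ℝ)) (b := 1)).exists_bound_of_continuousOn hc.continuousOn
  refine ⟨M, fun x => ?_⟩
  have h1 : F x = F (Int.fract x) := by
    have := hp.sub_int_mul_eq (x := x) ⌊x⌋
    rw [← this]; congr 1; rw [mul_one]; rfl
  rw [h1]; exact hM _ ⟨Int.fract_nonneg x, (Int.fract_lt_one x).le⟩

lemma BM.tp (c : ℤ →₀ ℂ) : BM (tp c) := BM.of_cont (cont_tp c) (tp_per c)

lemma BM.add {F G : ℝ → ℂ} (hF : BM F) (hG : BM G) : BM (fun x => F x + G x) := by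
  obtain ⟨A, hA⟩ := hF.bdd
  obtain ⟨B, hB⟩ := hG.bdd
  exact ⟨hF.meas.add hG.meas, ⟨A + B, fun x => (norm_add_le _ _).trans (add_le_add (hA x) (hB x))⟩, fun x => by simp [hF.per x, hG.per x]⟩

lemma BM.const_mul {F : ℝ → ℂ} (a : ℂ) (hF : BM F) : BM (fun x => a * F x) := by
  obtain ⟨A, hA⟩ := hF.bdd
  exact ⟨hF.meas.const_mul a, ⟨‖a‖ * A, fun x => by rw [norm_mul]; exact mul_le_mul_of_nonneg_left (hA x) (norm_nonneg _)⟩, fun x => by simp [hF.per x]⟩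

lemma BM.neg {F : ℝ → ℂ} (hF : BM F) : BM (fun x => - F x) := by
  simpa using hF.const_mul (-1)

lemma BM.sub {F G : ℝ → ℂ} (hF : BM F) (hG : BM G) : BM (fun x => F x - G x) := by
  simpa [sub_eq_add_neg] using hF.add hG.neg

lemma BM.shift {F : ℝ → ℂ} (hF : BM F) (h : ℝ) : BM (fun x => F (x + h)) := by
  obtain ⟨A, hA⟩ := hF.bdd
  refine ⟨hF.meas.comp (measurable_id.add_const h), ⟨A, fun x => hA _⟩, fun x => ?_⟩
  show F (x + 1 + h) = F (x + h)
  rw [show x + 1 + h = (x + h) + 1 by ring, hF.per]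

lemma BM.sum {ι : Type*} {s : Finset ι} {F : ι → ℝ → ℂ} (hF : ∀ i ∈ s, BM (F i)) : BM (fun x => ∑ i ∈ s, F i x) := by
  classical
  induction s using Finset.induction_on with
  | empty => simp; exact BM.of_cont continuous_const (fun x => rfl)
  | insert a s ha ih =>
    simp only [sum_insert ha]
    exact (hF a (mem_insert_self _ _)).add (ih fun i hi => hF i (mem_insert_of_mem hi))

/-- the measure on the period -/
noncomputable def μ : Measure ℝ := volume.restrict (Set.Ioc (0:ℝ) 1)

instance : IsProbabilityMeasure μ := ⟨by simp [μ]⟩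

noncomputable def nrm (p : ℝ) (F : ℝ → ℂ) : ℝ := (∫ x, ‖F x‖ ^ p ∂μ) ^ (1 / p)

lemma integral_mu {E : Type*} [NormedAddCommGroup E] [NormedSpace ℝ E] (g : ℝ → E) : ∫ x, g x ∂μ = ∫ x in (0:ℝ)..1, g x := by
  rw [intervalIntegral.integral_of_le zero_le_one]; rfl

lemma BM.memLp {F : ℝ → ℂ} (hF : BM F) (p : ENNReal) : MemLp F p μ := by
  obtain ⟨A, hA⟩ := hF.bdd
  exact MemLp.of_bound hF.meas.aestronglyMeasurable A (Eventually.of_forall hA)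

lemma BM.integrable {F : ℝ → ℂ} (hF : BM F) : Integrable F μ :=
  memLp_one_iff_integrable.1 (hF.memLp 1)

lemma BM.integrable_rpow {F : ℝ → ℂ} (hF : BM F) {p : ℝ} (hp : 0 < p) : Integrable (fun x => ‖F x‖ ^ p) μ := by
  have := (hF.memLp (ENNReal.ofReal p)).integrable_norm_rpow (by simpa using hp) (by simp)
  simpa [ENNReal.toReal_ofReal hp.le] using this

lemma nrm_eq {F : ℝ → ℂ} (hF : BM F) {p : ℝ} (hp : 0 < p) :
    nrm p F = (eLpNorm F (ENNReal.ofReal p) μ).toReal := by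
  rw [(hF.memLp _).eLpNorm_eq_integral_rpow_norm (by simpa using hp) (by simp)]
  rw [ENNReal.toReal_ofReal hp.le, ENNReal.toReal_ofReal, nrm, one_div]
  exact Real.rpow_nonneg (integral_nonneg fun x => Real.rpow_nonneg (norm_nonneg _) _) _

lemma nrm_nonneg (p : ℝ) (F : ℝ → ℂ) : 0 ≤ nrm p F :=
  Real.rpow_nonneg (integral_nonneg fun x => Real.rpow_nonneg (norm_nonneg _) _) _

lemma nrm_rpow (p : ℝ) (hp : 0 < p) (F : ℝ → ℂ) : nrm p F ^ p = ∫ x, ‖F x‖ ^ p ∂μ := by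
  unfold nrm; rw [← Real.rpow_mul (integral_nonneg fun x => Real.rpow_nonneg (norm_nonneg _) _)]
  field_simp; simp

lemma nrm_add_le {p : ℝ} (hp : 1 < p) {F G : ℝ → ℂ} (hF : BM F) (hG : BM G) :
    nrm p (fun x => F x + G x) ≤ nrm p F + nrm p G := by
  have h0 : 0 < p := by linarith
  rw [nrm_eq hF h0, nrm_eq hG h0, nrm_eq (hF.add hG) h0, ← ENNReal.toReal_add (hF.memLp _).eLpNorm_ne_top (hG.memLp _).eLpNorm_ne_top]
  apply ENNReal.toReal_mono (by simp [(hF.memLp _).eLpNorm_ne_top, (hG.memLp _).eLpNorm_ne_top])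
  exact eLpNorm_add_le hF.meas.aestronglyMeasurable hG.meas.aestronglyMeasurable (by simpa using hp.le)

lemma nrm_const_mul {p : ℝ} (hp : 1 < p) (a : ℂ) {F : ℝ → ℂ} : nrm p (fun x => a * F x) = ‖a‖ * nrm p F := by
  have h0 : 0 < p := by linarith
  unfold nrm
  simp_rw [norm_mul, Real.mul_rpow (norm_nonneg _) (norm_nonneg _), integral_const_mul]
  rw [Real.mul_rpow (by positivity) (integral_nonneg fun x => Real.rpow_nonneg (norm_nonneg _) _), ← Real.rpow_mul (norm_nonneg _)]
  field_simp; simp [mul_comm]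

lemma nrm_neg {p : ℝ} {F : ℝ → ℂ} : nrm p (fun x => - F x) = nrm p F := by
  simp [nrm]

lemma nrm_sub_le {p : ℝ} (hp : 1 < p) {F G : ℝ → ℂ} (hF : BM F) (hG : BM G) :
    nrm p (fun x => F x - G x) ≤ nrm p F + nrm p G := by
  simpa [sub_eq_add_neg, nrm_neg] using nrm_add_le hp hF hG.neg

lemma nrm_zero {p : ℝ} (hp : 1 < p) : nrm p (fun _ => 0) = 0 := by
  have h0 : 0 < p := by linarith
  simp [nrm, Real.zero_rpow h0.ne', Real.zero_rpow (inv_pos.2 h0).ne']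

lemma nrm_sum_le {p : ℝ} (hp : 1 < p) {ι : Type*} {s : Finset ι} {F : ι → ℝ → ℂ} (hF : ∀ i ∈ s, BM (F i)) :
    nrm p (fun x => ∑ i ∈ s, F i x) ≤ ∑ i ∈ s, nrm p (F i) := by
  classical
  induction s using Finset.induction_on with
  | empty => simp [nrm_zero hp]
  | insert a s ha ih =>
    simp only [sum_insert ha]
    refine (nrm_add_le hp (hF a (mem_insert_self _ _)) (BM.sum fun i hi => hF i (mem_insert_of_mem hi))).trans ?_
    gcongr
    exact ih fun i hi => hF i (mem_insert_of_mem hi)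

lemma nrm_mono {p : ℝ} (hp : 0 < p) {F G : ℝ → ℂ} (hF : BM F) (hG : BM G) (h : ∀ x, ‖F x‖ ≤ ‖G x‖) :
    nrm p F ≤ nrm p G := by
  unfold nrm
  apply Real.rpow_le_rpow (integral_nonneg fun x => Real.rpow_nonneg (norm_nonneg _) _) _ (by positivity)
  exact integral_mono (hF.integrable_rpow hp) (hG.integrable_rpow hp) fun x => Real.rpow_le_rpow (norm_nonneg _) (h x) hp.le

lemma nrm_congr_norm {p : ℝ} {F G : ℝ → ℂ} (h : ∀ x, ‖F x‖ = ‖G x‖) : nrm p F = nrm p G := by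
  simp [nrm, h]

lemma BM.const (a : ℂ) : BM (fun _ => a) := BM.of_cont continuous_const (fun _ => rfl)

lemma nrm_const {p : ℝ} (hp : 0 < p) (a : ℂ) : nrm p (fun _ => a) = ‖a‖ := by
  simp [nrm]; rw [← Real.rpow_mul (norm_nonneg _)]; field_simp; simp

lemma nrm_le_of_bound {p : ℝ} (hp : 0 < p) {F : ℝ → ℂ} (hF : BM F) {M : ℝ} (hM : 0 ≤ M) (h : ∀ x, ‖F x‖ ≤ M) : nrm p F ≤ M := by
  have := nrm_mono hp hF (BM.const (M : ℂ)) (by simpa [abs_of_nonneg hM] using h)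
  rw [nrm_const hp] at this; simpa [abs_of_nonneg hM] using this

lemma nrm_exp_mono {p q : ℝ} (hp : 0 < p) (hpq : p ≤ q) {F : ℝ → ℂ} (hF : BM F) : nrm p F ≤ nrm q F := by
  rw [nrm_eq hF hp, nrm_eq hF (hp.trans_le hpq)]
  apply ENNReal.toReal_mono (hF.memLp _).eLpNorm_ne_top
  exact eLpNorm_le_eLpNorm_of_exponent_le (ENNReal.ofReal_le_ofReal hpq) hF.meas.aestronglyMeasurable

lemma nrm_shift {p : ℝ} {F : ℝ → ℂ} (hF : BM F) (h : ℝ) : nrm p (fun x => F (x + h)) = nrm p F := by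
  unfold nrm; rw [integral_mu, integral_mu]
  congr 1
  rw [intervalIntegral.integral_comp_add_right (fun x => ‖F x‖ ^ p)]
  have : Function.Periodic (fun x => ‖F x‖ ^ p) 1 := fun x => by simp [hF.per x]
  have := this.intervalIntegral_add_eq h 0
  simpa [add_comm] using this

lemma holder {p q : ℝ} (hpq : p.HolderConjugate q) {F G : ℝ → ℂ} (hF : BM F) (hG : BM G) :
    ‖∫ x, F x * (starRingEnd ℂ) (G x) ∂μ‖ ≤ nrm p F * nrm q G := by
  refine (norm_integral_le_integral_norm _).trans ?_
  simp only [norm_mul, RCLike.norm_conj]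
  exact integral_mul_norm_le_Lp_mul_Lq hpq (hF.memLp _) (hG.memLp _)

lemma integral_e (l : ℤ) : ∫ x, e l x ∂μ = if l = 0 then 1 else 0 := by
  split_ifs with h
  · subst h; simp [e_zero]
  · rw [integral_mu]
    have hc : (2 * Real.pi * Complex.I * l : ℂ) ≠ 0 := by
      simp [h, Real.pi_ne_zero]
    unfold e
    rw [integral_exp_mul_complex hc]
    have := e_int l 1
    simp only [e] at this
    push_cast at this
    simp only [Complex.ofReal_one, Complex.ofReal_zero, mul_zero, Complex.exp_zero, this, sub_self, zero_div]

lemma integral_tp_conj (c d : ℤ →₀ ℂ) :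
    ∫ x, tp c x * (starRingEnd ℂ) (tp d x) ∂μ = ∑ l ∈ c.support, c l * (starRingEnd ℂ) (d l) := by
  have hi : ∀ F : ℝ → ℂ, Continuous F → Integrable F μ := fun F hF =>
    (hF.integrableOn_Icc (a := 0) (b := 1)).mono_set Set.Ioc_subset_Icc_self
  have h1 : ∀ x, tp c x * (starRingEnd ℂ) (tp d x) =
      ∑ l ∈ c.support, ∑ m ∈ d.support, c l * (starRingEnd ℂ) (d m) * e (l - m) x := by
    intro x
    unfold tp Finsupp.sum
    rw [map_sum, sum_mul_sum]
    refine sum_congr rfl fun l _ => sum_congr rfl fun m _ => ?_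
    rw [map_mul, conj_e, sub_eq_add_neg, e_add]; ring
  simp_rw [h1]
  rw [integral_finsetSum _ (fun l _ => hi _ (by fun_prop))]
  refine sum_congr rfl fun l _ => ?_
  rw [integral_finsetSum _ (fun m _ => hi _ (by fun_prop))]
  simp_rw [integral_const_mul, integral_e, sub_eq_zero]
  simp only [mul_ite, mul_one, mul_zero, sum_ite_eq, Finsupp.mem_support_iff]
  by_cases h : d l = 0 <;> simp [h]
end MZ

namespace MZ

lemma weier {G : ℝ → ℂ} (hc : Continuous G) (hp : Function.Periodic G 1) {ε : ℝ} (hε : 0 < ε) :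
    ∃ c : ℤ →₀ ℂ, ∀ x, ‖G x - tp c x‖ ≤ ε := by
  have : Fact (0 < (1:ℝ)) := ⟨one_pos⟩
  let g : C(AddCircle (1:ℝ), ℂ) := ⟨hp.lift, by
    apply continuous_coinduced_dom.2
    exact hc⟩
  have h1 : g ∈ (Submodule.span ℂ (Set.range (@fourier (1:ℝ)))).topologicalClosure := by
    rw [span_fourier_closure_eq_top]; trivial
  have h2 : g ∈ closure ((Submodule.span ℂ (Set.range (@fourier (1:ℝ))) : Set C(AddCircle (1:ℝ), ℂ))) := h1
  obtain ⟨k, hk, hd⟩ := Metric.mem_closure_iff.1 h2 ε hε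
  obtain ⟨c, hc'⟩ := (Finsupp.mem_span_range_iff_exists_finsupp).1 hk
  refine ⟨c, fun x => ?_⟩
  have h3 : k (x : AddCircle (1:ℝ)) = tp c x := by
    rw [← hc']
    simp only [Finsupp.sum, ContinuousMap.coe_sum, Finset.sum_apply, ContinuousMap.coe_smul, Pi.smul_apply, tp, smul_eq_mul]
    refine sum_congr rfl fun l _ => ?_
    rw [fourier_coe_apply]; simp [e]
  have h4 : g (x : AddCircle (1:ℝ)) = G x := rfl
  rw [← h3, ← h4]
  have := ContinuousMap.norm_coe_le_norm (g - k) (x : AddCircle (1:ℝ))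
  rw [dist_eq_norm] at hd
  exact (this.trans hd.le)

/-- conjugate reflection -/
noncomputable def cr (c : ℤ →₀ ℂ) : ℤ →₀ ℂ :=
  Finsupp.equivMapDomain (Equiv.neg ℤ) (c.mapRange (starRingEnd ℂ) (by simp))

@[simp] lemma cr_apply (c : ℤ →₀ ℂ) (l : ℤ) : cr c l = (starRingEnd ℂ) (c (-l)) := by
  simp [cr]

lemma tp_cr (c : ℤ →₀ ℂ) (x : ℝ) : tp (cr c) x = (starRingEnd ℂ) (tp c x) := by
  unfold tp cr
  rw [Finsupp.sum_equivMapDomain, Finsupp.sum_mapRange_index (by simp)]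
  simp only [Finsupp.sum, map_sum, map_mul, conj_e, Equiv.neg_apply]

noncomputable def rp (c : ℤ →₀ ℂ) : ℤ →₀ ℂ := (1 / 2 : ℂ) • (c + cr c)
lemma tp_rp (c : ℤ →₀ ℂ) (x : ℝ) : tp (rp c) x = ((tp c x).re : ℂ) := by
  rw [rp, tp_smul, tp_add, tp_cr, Complex.add_conj]; push_cast; ring
lemma cr_rp (c : ℤ →₀ ℂ) : cr (rp c) = rp c := by
  ext l; simp [rp, Complex.conj_ofNat]; ring
noncomputable def ip (c : ℤ →₀ ℂ) : ℤ →₀ ℂ := rp ((-Complex.I) • c)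
lemma rp_ip (c : ℤ →₀ ℂ) : c = rp c + Complex.I • ip c := by
  ext l; simp [rp, ip]; ring_nf; simp; ring

/-- projection to nonnegative frequencies -/
noncomputable def pos (c : ℤ →₀ ℂ) : ℤ →₀ ℂ := mul (fun l => if 0 ≤ l then 1 else 0) c
noncomputable def ana (c : ℤ →₀ ℂ) : ℤ →₀ ℂ := mul (fun l => if l < 0 then 0 else if l = 0 then 1 else 2) c

lemma pos_eq (c : ℤ →₀ ℂ) : pos c = (1 / 2 : ℂ) • (ana c + Finsupp.single 0 (c 0)) := by
  ext l
  rcases lt_trichotomy l 0 with h | h | h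
  · simp [pos, ana, h, h.ne', not_le.2 h]
  · subst h; simp [pos, ana]; ring
  · simp [pos, ana, h.le, h.ne', not_lt.2 h.le]

lemma ana_re {c : ℤ →₀ ℂ} (hc : cr c = c) (x : ℝ) : tp c x = ((tp (ana c) x).re : ℂ) := by
  rw [← tp_rp]; congr 1; ext l
  have h1 : (starRingEnd ℂ) (c (-l)) = c l := by rw [← cr_apply, hc]
  rcases lt_trichotomy l 0 with h | h | h
  · simp [rp, ana, h, h1, not_lt.2 h.le, h.ne, Complex.conj_ofNat]
  · subst h; simp at h1; simp [rp, ana, h1]; ring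
  · simp [rp, ana, h, h1, not_lt.2 h.le, h.ne', Complex.conj_ofNat]

noncomputable def anaZ (c : ℤ →₀ ℂ) (z : ℂ) : ℂ :=
  c.sum fun l a => (if l < 0 then 0 else if l = 0 then 1 else 2) * a * z ^ l.toNat

lemma e_one_pow (x : ℝ) (k : ℕ) : e 1 x ^ k = e k x := by
  induction k with
  | zero => simp [e_zero]
  | succ k ih => rw [pow_succ, ih, ← e_add]; push_cast; rfl

lemma anaZ_e (c : ℤ →₀ ℂ) (x : ℝ) : anaZ c (e 1 x) = tp (ana c) x := by
  unfold anaZ ana; rw [tp_mul]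
  apply Finsupp.sum_congr; intro l _
  by_cases h : l < 0
  · simp [h]
  · rw [e_one_pow, Int.toNat_of_nonneg (not_lt.1 h)]

lemma anaZ_zero (c : ℤ →₀ ℂ) : anaZ c 0 = c 0 := by
  unfold anaZ Finsupp.sum
  rw [Finset.sum_eq_single 0]
  · simp
  · intro l _ hl
    by_cases h : l < 0
    · simp [h]
    · have : l.toNat ≠ 0 := by omega
      simp [this]
  · intro h; simp at h; simp [h]

lemma anaZ_diff (c : ℤ →₀ ℂ) : Differentiable ℂ (anaZ c) := by
  unfold anaZ Finsupp.sum; fun_prop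

lemma anaZ_re_pos {c : ℤ →₀ ℂ} (h : ∀ x, 0 < (tp (ana c) x).re) {z : ℂ} (hz : z ∈ Metric.closedBall (0:ℂ) 1) :
    0 < (anaZ c z).re := by
  have hsph : ∀ z ∈ Metric.sphere (0:ℂ) 1, ∃ x : ℝ, z = e 1 x := by
    intro z hz
    have hz1 : ‖z‖ = 1 := by simpa using hz
    refine ⟨Complex.arg z / (2 * Real.pi), ?_⟩
    have := Complex.norm_mul_exp_arg_mul_I z
    rw [hz1] at this
    conv_lhs => rw [← this]
    unfold e; simp
    congr 1; field_simp
  have hcont : ContinuousOn (fun z => (anaZ c z).re) (Metric.sphere (0:ℂ) 1) :=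
    (Complex.continuous_re.comp (anaZ_diff c).continuous).continuousOn
  obtain ⟨w, hw, hmin⟩ := (isCompact_sphere (0:ℂ) 1).exists_isMinOn ⟨1, by simp⟩ hcont
  have hwpos : 0 < (anaZ c w).re := by
    obtain ⟨x, rfl⟩ := hsph w hw; rw [anaZ_e]; exact h x
  have key : ‖Complex.exp (- anaZ c z)‖ ≤ Real.exp (-(anaZ c w).re) := by
    apply Complex.norm_le_of_forall_mem_frontier_norm_le (U := Metric.ball (0:ℂ) 1) (f := fun z => Complex.exp (- anaZ c z)) Metric.isBounded_ball
    · exact ((anaZ_diff c).neg.cexp).diffContOnCl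
    · intro y hy
      rw [frontier_ball _ one_ne_zero] at hy
      rw [Complex.norm_exp]; simp; exact hmin hy
    · rw [closure_ball _ one_ne_zero]; exact hz
  rw [Complex.norm_exp] at key
  have := Real.exp_le_exp.1 key
  simp at this; linarith

lemma mean_cpow {c : ℤ →₀ ℂ} (h : ∀ x, 0 < (tp (ana c) x).re) (p : ℝ) :
    ∫ x, (tp (ana c) x) ^ (p : ℂ) ∂μ = (c 0) ^ (p : ℂ) := by
  have hd : DiffContOnCl ℂ (fun z => anaZ c z ^ (p : ℂ)) (Metric.ball (0:ℂ) |1|) := by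
    apply DifferentiableOn.diffContOnCl
    rw [abs_one, closure_ball _ one_ne_zero]
    intro z hz
    exact ((anaZ_diff c z).cpow_const (Or.inl (anaZ_re_pos h hz))).differentiableWithinAt
  have := hd.circleAverage
  rw [anaZ_zero] at this
  rw [← this, Real.circleAverage_def, integral_mu]
  have h2 := intervalIntegral.integral_comp_mul_left (a := 0) (b := 1) (fun θ => anaZ c (circleMap 0 1 θ) ^ (p:ℂ)) (c := 2 * Real.pi) (by positivity)
  simp only [mul_zero, mul_one] at h2
  rw [← h2]
  congr 1; ext x
  rw [← anaZ_e]; congr 2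
  simp [circleMap, e]; ring_nf

lemma pointwise {p : ℝ} (hp : 1 < p) (hp2 : p ≤ 2) : ∃ A B : ℝ, 0 < A ∧ 0 < B ∧
    ∀ z : ℂ, 0 < z.re → |z.im| ^ p ≤ A * z.re ^ p - B * (z ^ (p : ℂ)).re := by
  have hπ := Real.pi_pos
  have hp0 : 0 < p := by linarith
  set t := Real.pi * (1 + p) / (4 * p) with ht
  have hpt : p * t = Real.pi * (1 + p) / 4 := by rw [ht]; field_simp
  have ht0 : 0 < t := by rw [ht]; positivity
  have ht2 : t < Real.pi / 2 := by
    rw [ht, div_lt_div_iff₀ (by positivity) (by positivity)]; nlinarith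
  have hcosn : Real.cos (p * t) < 0 := by
    apply Real.cos_neg_of_pi_div_two_lt_of_lt <;> rw [hpt] <;> nlinarith
  have hcosp : 0 < Real.cos t := Real.cos_pos_of_mem_Ioo ⟨by linarith, ht2⟩
  set κ := - Real.cos (p * t) with hκ
  have hκ0 : 0 < κ := by rw [hκ]; linarith
  set D := (Real.cos t) ^ p with hD
  have hD0 : 0 < D := Real.rpow_pos_of_pos hcosp _
  refine ⟨(1 + 1 / κ) / D, 1 / κ, by positivity, by positivity, ?_⟩
  intro z hz
  rw [Complex.cpow_ofReal_re]
  have hre : z.re = ‖z‖ * Real.cos z.arg := (Complex.norm_mul_cos_arg z).symm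
  have him : z.im = ‖z‖ * Real.sin z.arg := (Complex.norm_mul_sin_arg z).symm
  set θ := z.arg with hθ
  have hθ2 : |θ| < Real.pi / 2 := Complex.abs_arg_lt_pi_div_two_iff.2 (Or.inl hz)
  have hcosθ : 0 < Real.cos θ := by
    apply Real.cos_pos_of_mem_Ioo; rw [abs_lt] at hθ2; exact ⟨by linarith, by linarith⟩
  have hcosabs : Real.cos (θ * p) = Real.cos (p * |θ|) := by
    rw [← Real.cos_abs, abs_mul, abs_of_pos hp0, mul_comm]
  rw [hcosabs, hre, him, abs_mul, abs_of_nonneg (norm_nonneg z), Real.mul_rpow (norm_nonneg _) (abs_nonneg _), Real.mul_rpow (norm_nonneg _) hcosθ.le]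
  have main : |Real.sin θ| ^ p ≤ (1 + 1 / κ) / D * Real.cos θ ^ p - 1 / κ * Real.cos (p * |θ|) := by
    have hs : |Real.sin θ| ^ p ≤ 1 := Real.rpow_le_one (abs_nonneg _) (Real.abs_sin_le_one _) hp0.le
    rcases le_total t |θ| with h | h
    · have h1 : Real.cos (p * |θ|) ≤ -κ := by
        rw [hκ, neg_neg]
        apply Real.cos_le_cos_of_nonneg_of_le_pi (by positivity) (by nlinarith) (by gcongr)
      have h2 : 1 ≤ - (1 / κ * Real.cos (p * |θ|)) := by
        have : 1 / κ * Real.cos (p * |θ|) ≤ 1 / κ * (-κ) := by gcongr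
        have h3 : 1 / κ * (-κ) = -1 := by field_simp
        linarith
      have : 0 ≤ (1 + 1 / κ) / D * Real.cos θ ^ p := by positivity
      linarith
    · have h1 : Real.cos t ≤ Real.cos θ := by
        rw [← Real.cos_abs θ]
        exact Real.cos_le_cos_of_nonneg_of_le_pi (abs_nonneg _) (by linarith) h
      have h2 : D ≤ Real.cos θ ^ p := Real.rpow_le_rpow hcosp.le h1 hp0.le
      have h3 : (1 + 1 / κ) ≤ (1 + 1 / κ) / D * Real.cos θ ^ p := by
        rw [div_mul_eq_mul_div, le_div_iff₀ hD0]; gcongr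
      have h4 : 1 / κ * Real.cos (p * |θ|) ≤ 1 / κ * 1 := by
        gcongr; exact Real.cos_le_one _
      linarith
  have hz0 : 0 ≤ ‖z‖ ^ p := Real.rpow_nonneg (norm_nonneg _) _
  nlinarith [mul_le_mul_of_nonneg_left main hz0]
end MZ

namespace MZ

lemma norm_coeff_le {p : ℝ} (hp : 1 < p) (c : ℤ →₀ ℂ) : ‖c 0‖ ≤ nrm p (tp c) := by
  have hpq := Real.HolderConjugate.conjExponent hp
  have h1 := holder hpq (BM.tp c) (BM.const 1)
  have h2 : ∫ x, tp c x * (starRingEnd ℂ) 1 ∂μ = c 0 := by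
    have h3 := integral_tp_conj c (Finsupp.single 0 1)
    simp only [tp_single, e_zero, mul_one] at h3 ⊢
    rw [h3, Finset.sum_eq_single 0]
    · simp
    · intro l _ hl; simp [Finsupp.single_apply, hl.symm]
    · intro h; simp at h; simp [h]
  rw [h2, nrm_const hpq.symm.pos] at h1
  simpa using h1

lemma riesz_pos {p : ℝ} (hp : 1 < p) (hp2 : p ≤ 2) : ∃ C : ℝ, 0 < C ∧ ∀ c : ℤ →₀ ℂ, cr c = c →
    (∀ x, 0 < (tp c x).re) → nrm p (tp (pos c)) ≤ C * nrm p (tp c) := by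
  obtain ⟨A, B, hA, hB, h⟩ := pointwise hp hp2
  have hp0 : 0 < p := by linarith
  refine ⟨1 + A ^ (1 / p), by positivity, fun c hc hpos => ?_⟩
  have hre : ∀ x, 0 < (tp (ana c) x).re := by
    intro x; have := hpos x; rw [ana_re hc] at this; simpa using this
  have hc0 : 0 ≤ ((c 0) ^ (p : ℂ)).re := by
    have h1 : 0 < (c 0).re := by
      have := anaZ_re_pos hre (z := 0) (by simp); rwa [anaZ_zero] at this
    have h2 : (c 0).im = 0 := by
      have : cr c 0 = c 0 := by rw [hc]
      simp at this
      exact Complex.conj_eq_iff_im.1 this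
    have h3 : c 0 = ((c 0).re : ℂ) := by apply Complex.ext <;> simp [h2]
    rw [h3, ← Complex.ofReal_cpow h1.le]
    simp; positivity
  have hcont : Continuous (fun x => tp (ana c) x ^ (p : ℂ)) := by
    rw [continuous_iff_continuousAt]; intro x
    exact ((cont_tp (ana c)).continuousAt).cpow continuousAt_const (Or.inl (hre x))
  have hint : Integrable (fun x => tp (ana c) x ^ (p : ℂ)) μ :=
    (hcont.integrableOn_Icc (a := 0) (b := 1)).mono_set Set.Ioc_subset_Icc_self
  have hint' : Integrable (fun x => (tp (ana c) x ^ (p : ℂ)).re) μ := hint.re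
  have hbu : BM (fun x => ((tp (ana c) x).re : ℂ)) := by
    simp_rw [← tp_rp]; exact BM.tp _
  have hbv : BM (fun x => Complex.I * ((tp (ana c) x).im : ℂ)) :=
    BM.of_cont (by fun_prop) (fun x => by simp [tp_per (ana c) x])
  have hu : nrm p (fun x => ((tp (ana c) x).re : ℂ)) = nrm p (tp c) := by
    congr 1; ext x; rw [← ana_re hc]
  have hv : nrm p (fun x => Complex.I * ((tp (ana c) x).im : ℂ)) ≤ A ^ (1 / p) * nrm p (tp c) := by
    rw [← hu]
    unfold nrm
    rw [← Real.mul_rpow hA.le (integral_nonneg fun x => Real.rpow_nonneg (norm_nonneg _) _)]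
    apply Real.rpow_le_rpow (integral_nonneg fun x => Real.rpow_nonneg (norm_nonneg _) _) _ (by positivity)
    calc ∫ x, ‖Complex.I * ((tp (ana c) x).im : ℂ)‖ ^ p ∂μ
        ≤ ∫ x, (A * ‖((tp (ana c) x).re : ℂ)‖ ^ p - B * (tp (ana c) x ^ (p : ℂ)).re) ∂μ := by
          apply integral_mono (hbv.integrable_rpow hp0)
          · exact ((hbu.integrable_rpow hp0).const_mul A).sub (hint'.const_mul B)
          · intro x
            have := h _ (hre x)
            simpa [abs_of_pos (hre x)] using this
      _ = A * ∫ x, ‖((tp (ana c) x).re : ℂ)‖ ^ p ∂μ - B * ((c 0) ^ (p : ℂ)).re := by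
          rw [integral_sub ((hbu.integrable_rpow hp0).const_mul A) (hint'.const_mul B), integral_const_mul, integral_const_mul, ← mean_cpow hre]
          congr 2
          exact integral_re hint
      _ ≤ _ := by nlinarith [mul_nonneg hB.le hc0]
  have hF : nrm p (tp (ana c)) ≤ (1 + A ^ (1 / p)) * nrm p (tp c) := by
    have h1 : tp (ana c) = fun x => ((tp (ana c) x).re : ℂ) + Complex.I * ((tp (ana c) x).im : ℂ) := by
      ext x; rw [mul_comm]; exact (Complex.re_add_im _).symm
    rw [h1]
    refine (nrm_add_le hp hbu hbv).trans ?_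
    rw [hu]; linarith
  have h5 : tp (pos c) = fun x => (1/2 : ℂ) * (tp (ana c) x + c 0) := by
    ext x; rw [pos_eq, tp_smul, tp_add, tp_single, e_zero, mul_one]
  rw [h5, nrm_const_mul hp]
  have h6 := nrm_add_le hp (BM.tp (ana c)) (BM.const (c 0))
  rw [nrm_const hp0] at h6
  have h7 := norm_coeff_le hp c
  have h8 : 0 ≤ A ^ (1 / p) * nrm p (tp c) := mul_nonneg (by positivity) (nrm_nonneg _ _)
  have h9 : ‖(1/2 : ℂ)‖ = 1/2 := by simp
  rw [h9]; linarith

lemma parseval (c : ℤ →₀ ℂ) : nrm 2 (tp c) ^ 2 = ∑ l ∈ c.support, ‖c l‖ ^ 2 := by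
  have h1 := nrm_rpow 2 two_pos (tp c)
  have h2 := integral_tp_conj c c
  simp only [Complex.mul_conj, Complex.normSq_eq_norm_sq] at h2
  rw [integral_complex_ofReal] at h2
  norm_cast at h2 
  have h3 : nrm 2 (tp c) ^ (2:ℝ) = nrm 2 (tp c) ^ 2 := by norm_cast
  rw [← h3, h1, ← h2]; congr 1; ext x; norm_cast

lemma pos_two (c : ℤ →₀ ℂ) : nrm 2 (tp (pos c)) ≤ nrm 2 (tp c) := by
  have : nrm 2 (tp (pos c)) ^ 2 ≤ nrm 2 (tp c) ^ 2 := by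
    rw [parseval, parseval]
    have hs : (pos c).support ⊆ c.support := by
      intro l; simp [pos]
    refine (Finset.sum_le_sum_of_subset_of_nonneg hs (fun _ _ _ => by positivity)).trans ?_
    refine sum_le_sum fun l _ => ?_
    simp only [pos, mul_apply]
    split_ifs
    · simp
    · simp
  exact (pow_le_pow_iff_left₀ (nrm_nonneg _ _) (nrm_nonneg _ _) two_ne_zero).1 this

/-- approximate a nonnegative continuous periodic real function from above by a positive polynomial -/
lemma approx_pos {g : ℝ → ℝ} (hc : Continuous g) (hper : Function.Periodic g 1) (h0 : ∀ x, 0 ≤ g x)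
    {ε : ℝ} (hε : 0 < ε) : ∃ c : ℤ →₀ ℂ, cr c = c ∧ (∀ x, 0 < (tp c x).re) ∧ ∀ x, ‖tp c x - (g x : ℂ)‖ ≤ 3 * ε := by
  obtain ⟨c, h⟩ := weier (G := fun x => ((g x + 2 * ε : ℝ) : ℂ)) (by fun_prop) (fun x => by simp [hper x]) hε
  have hr : ∀ x, |g x + 2 * ε - (tp c x).re| ≤ ε := by
    intro x
    have h1 := Complex.abs_re_le_norm (((g x + 2 * ε : ℝ) : ℂ) - tp c x)
    simp only [Complex.sub_re, Complex.ofReal_re] at h1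
    exact h1.trans (h x)
  refine ⟨rp c, cr_rp c, fun x => ?_, fun x => ?_⟩
  · rw [tp_rp]; simp
    have := abs_le.1 (hr x); have := h0 x; linarith
  · rw [tp_rp, ← Complex.ofReal_sub, Complex.norm_real, Real.norm_eq_abs]
    have := abs_le.1 (hr x); rw [abs_le]; constructor <;> linarith

lemma pos_add (c d : ℤ →₀ ℂ) : pos (c + d) = pos c + pos d := mul_add' _ _ _
lemma pos_sub (c d : ℤ →₀ ℂ) : pos (c - d) = pos c - pos d := mul_sub' _ _ _
lemma pos_smul (a : ℂ) (c : ℤ →₀ ℂ) : pos (a • c) = a • pos c := mul_smul' _ _ _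

lemma nrm_tp_add {p : ℝ} (hp : 1 < p) (c d : ℤ →₀ ℂ) : nrm p (tp (c + d)) ≤ nrm p (tp c) + nrm p (tp d) := by
  have h : tp (c + d) = fun x => tp c x + tp d x := by ext x; rw [tp_add]
  rw [h]; exact nrm_add_le hp (BM.tp c) (BM.tp d)
lemma nrm_tp_sub {p : ℝ} (hp : 1 < p) (c d : ℤ →₀ ℂ) : nrm p (tp (c - d)) ≤ nrm p (tp c) + nrm p (tp d) := by
  have h : tp (c - d) = fun x => tp c x - tp d x := by ext x; rw [tp_sub]
  rw [h]; exact nrm_sub_le hp (BM.tp c) (BM.tp d)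
lemma nrm_tp_smul {p : ℝ} (hp : 1 < p) (a : ℂ) (c : ℤ →₀ ℂ) : nrm p (tp (a • c)) = ‖a‖ * nrm p (tp c) := by
  have h : tp (a • c) = fun x => a * tp c x := by ext x; rw [tp_smul]
  rw [h]; exact nrm_const_mul hp a

lemma riesz_real {p : ℝ} (hp : 1 < p) (hp2 : p ≤ 2) : ∃ C : ℝ, 0 < C ∧ ∀ c : ℤ →₀ ℂ, cr c = c →
    nrm p (tp (pos c)) ≤ C * nrm p (tp c) := by
  obtain ⟨C, hC, h⟩ := riesz_pos hp hp2
  have hp0 : 0 < p := by linarith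
  refine ⟨2 * C, by positivity, fun c hc => ?_⟩
  have hre : ∀ x, tp c x = ((tp c x).re : ℂ) := by
    intro x; rw [← tp_rp]; congr 1; rw [rp, hc]; ext l; simp; ring
  have hcr : Continuous fun x => (tp c x).re := Complex.continuous_re.comp (cont_tp c)
  have hper : ∀ x, (tp c (x + 1)).re = (tp c x).re := fun x => by rw [tp_per c x]
  suffices H : ∀ ε : ℝ, 0 < ε → nrm p (tp (pos c)) ≤ 2 * C * nrm p (tp c) + (6 * C + 6) * ε by
    apply le_of_forall_pos_le_add
    intro η hη
    have := H (η / (6 * C + 6)) (by positivity)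
    rwa [mul_div_cancel₀ _ (by positivity)] at this
  intro ε hε
  have aux : ∀ s : ℝ, |s| = 1 → ∃ d : ℤ →₀ ℂ, (∀ x, ‖tp d x - ((max (s * (tp c x).re) 0 : ℝ) : ℂ)‖ ≤ 3 * ε) ∧ nrm p (tp (pos d)) ≤ C * (nrm p (tp c) + 3 * ε) := by
    intro s hs
    obtain ⟨d, hd1, hd2, hd3⟩ := approx_pos (g := fun x => max (s * (tp c x).re) 0) (by fun_prop)
      (fun x => by simp only [hper x]) (fun x => le_max_right _ _) hε
    refine ⟨d, hd3, (h d hd1 hd2).trans ?_⟩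
    gcongr
    have hb : BM (fun x => ((max (s * (tp c x).re) 0 : ℝ) : ℂ)) := BM.of_cont (by fun_prop) (fun x => by simp only [hper x])
    have h1 : tp d = fun x => ((max (s * (tp c x).re) 0 : ℝ) : ℂ) + (tp d x - ((max (s * (tp c x).re) 0 : ℝ) : ℂ)) := by
      ext x; ring
    rw [h1]
    refine (nrm_add_le hp hb ((BM.tp d).sub hb)).trans ?_
    refine add_le_add (nrm_mono hp0 hb (BM.tp c) fun x => ?_) (nrm_le_of_bound hp0 ((BM.tp d).sub hb) (by positivity) hd3)
    rw [Complex.norm_real, Real.norm_eq_abs, abs_of_nonneg (le_max_right _ _)]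
    refine max_le ?_ (norm_nonneg _)
    refine (le_abs_self _).trans ?_
    rw [abs_mul, hs, one_mul]; exact Complex.abs_re_le_norm _
  obtain ⟨d1, h1, h1'⟩ := aux 1 (by simp)
  obtain ⟨d2, h2, h2'⟩ := aux (-1) (by simp)
  have hr : nrm p (tp (pos (c - (d1 - d2)))) ≤ 6 * ε := by
    refine (nrm_exp_mono hp0 hp2 (BM.tp _)).trans ((pos_two _).trans ?_)
    refine nrm_le_of_bound two_pos (BM.tp _) (by positivity) fun x => ?_
    rw [tp_sub, tp_sub]
    have e1 : tp c x = ((max (1 * (tp c x).re) 0 : ℝ) : ℂ) - ((max (-1 * (tp c x).re) 0 : ℝ) : ℂ) := by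
      conv_lhs => rw [hre x]
      rw [← Complex.ofReal_sub]; congr 1
      rcases le_total 0 (tp c x).re with h | h
      · rw [max_eq_left (by linarith), max_eq_right (by linarith)]; ring
      · rw [max_eq_right (by linarith), max_eq_left (by linarith)]; ring
    have e2 : tp c x - (tp d1 x - tp d2 x) = (tp d2 x - ((max (-1 * (tp c x).re) 0 : ℝ) : ℂ)) - (tp d1 x - ((max (1 * (tp c x).re) 0 : ℝ) : ℂ)) := by
      conv_lhs => rw [e1]
      ring
    rw [e2]
    refine (norm_sub_le _ _).trans ?_
    have := h1 x; have := h2 x; linarith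
  have hsplit : pos c = (pos d1 - pos d2) + pos (c - (d1 - d2)) := by
    rw [pos_sub, pos_sub]; abel
  rw [hsplit]
  have t1 := nrm_tp_add hp (pos d1 - pos d2) (pos (c - (d1 - d2)))
  have t2 := nrm_tp_sub hp (pos d1) (pos d2)
  linarith

lemma riesz_le_two {p : ℝ} (hp : 1 < p) (hp2 : p ≤ 2) : ∃ C : ℝ, 0 < C ∧ ∀ c : ℤ →₀ ℂ,
    nrm p (tp (pos c)) ≤ C * nrm p (tp c) := by
  obtain ⟨C, hC, h⟩ := riesz_real hp hp2
  have hp0 : 0 < p := by linarith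
  refine ⟨2 * C, by positivity, fun c => ?_⟩
  have key : ∀ c : ℤ →₀ ℂ, nrm p (tp (rp c)) ≤ nrm p (tp c) := fun c => by
    refine nrm_mono hp0 (BM.tp _) (BM.tp _) fun x => ?_
    rw [tp_rp, Complex.norm_real]; exact Complex.abs_re_le_norm _
  have h1 := (h (rp c) (cr_rp c)).trans (mul_le_mul_of_nonneg_left (key c) hC.le)
  have h2 := (h (ip c) (cr_rp _)).trans (mul_le_mul_of_nonneg_left (key _) hC.le)
  rw [nrm_tp_smul hp] at h2
  simp at h2
  have h3 : pos c = pos (rp c) + Complex.I • pos (ip c) := by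
    rw [← pos_smul, ← pos_add, ← rp_ip]
  rw [h3]
  have h4 := nrm_tp_add hp (pos (rp c)) (Complex.I • pos (ip c))
  rw [nrm_tp_smul hp] at h4
  simp at h4
  linarith
end MZ

namespace MZ

lemma cont_dual {p : ℝ} (hp : 1 < p) : Continuous (fun z : ℂ => ((‖z‖ ^ (p - 2) : ℝ) : ℂ) * z) := by
  rw [continuous_iff_continuousAt]
  intro z
  by_cases hz : z = 0
  · subst hz
    unfold ContinuousAt
    simp only [mul_zero]
    rw [tendsto_zero_iff_norm_tendsto_zero]
    have h1 : ∀ z : ℂ, ‖((‖z‖ ^ (p - 2) : ℝ) : ℂ) * z‖ = ‖z‖ ^ (p - 1) := by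
      intro z
      rw [norm_mul, Complex.norm_real, Real.norm_eq_abs, abs_of_nonneg (Real.rpow_nonneg (norm_nonneg _) _)]
      by_cases h : z = 0
      · subst h; simp; rw [Real.zero_rpow (by linarith)]
      · have : p - 1 = (p - 2) + 1 := by ring
        rw [this, Real.rpow_add_one (norm_ne_zero_iff.2 h)]
    simp_rw [h1]
    have : ContinuousAt (fun z : ℂ => ‖z‖ ^ (p - 1)) 0 :=
      (continuous_norm.continuousAt).rpow_const (Or.inr (by linarith))
    unfold ContinuousAt at this
    simpa [Real.zero_rpow (show p - 1 ≠ 0 by linarith)] using this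
  · have : ContinuousAt (fun z : ℂ => ‖z‖ ^ (p - 2)) z :=
      (continuous_norm.continuousAt).rpow_const (Or.inl (norm_ne_zero_iff.2 hz))
    exact (Complex.continuous_ofReal.continuousAt.comp this).mul continuousAt_id

lemma dual {p q : ℝ} (hpq : p.HolderConjugate q) {G : ℝ → ℂ} (hc : Continuous G) (hper : Function.Periodic G 1)
    {A : ℝ} (hA : 0 ≤ A) (h : ∀ d : ℤ →₀ ℂ, ‖∫ x, G x * (starRingEnd ℂ) (tp d x) ∂μ‖ ≤ A * nrm q (tp d)) :
    nrm p G ≤ A := by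
  have hp := hpq.lt
  have hq := hpq.symm.lt
  have hp0 := hpq.pos
  have hq0 := hpq.symm.pos
  set g : ℝ → ℂ := fun x => ((‖G x‖ ^ (p - 2) : ℝ) : ℂ) * G x with hg
  have hgc : Continuous g := (cont_dual hp).comp hc
  have hgp : Function.Periodic g 1 := fun x => by simp only [hg, hper x]
  have hGb := BM.of_cont hc hper
  have hgb := BM.of_cont hgc hgp
  set N := nrm p G with hN
  have hN0 : 0 ≤ N := nrm_nonneg _ _
  have e1 : ∀ x, G x * (starRingEnd ℂ) (g x) = ((‖G x‖ ^ p : ℝ) : ℂ) := by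
    intro x
    simp only [hg, map_mul, Complex.conj_ofReal]
    rw [mul_left_comm, Complex.mul_conj, Complex.normSq_eq_norm_sq, ← Complex.ofReal_mul]
    congr 1
    by_cases h0 : ‖G x‖ = 0
    · rw [h0, Real.zero_rpow hp0.ne']; simp
    · have : 0 < ‖G x‖ := lt_of_le_of_ne (norm_nonneg _) (Ne.symm h0)
      rw [← Real.rpow_natCast, ← Real.rpow_add this]; norm_num
  have e2 : ∀ x, ‖g x‖ ^ q = ‖G x‖ ^ p := by
    intro x
    have hq1 : (p - 1) * q = p := hpq.sub_one_mul_conj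
    by_cases h0 : ‖G x‖ = 0
    · simp only [hg, norm_mul, h0, mul_zero]; rw [Real.zero_rpow hp0.ne', Real.zero_rpow hq0.ne']
    · have hpos : 0 < ‖G x‖ := lt_of_le_of_ne (norm_nonneg _) (Ne.symm h0)
      have : ‖g x‖ = ‖G x‖ ^ (p - 1) := by
        simp only [hg, norm_mul, Complex.norm_real, Real.norm_eq_abs]
        rw [abs_of_nonneg (Real.rpow_nonneg (norm_nonneg _) _), ← Real.rpow_add_one h0]; congr 1; ring
      rw [this, ← Real.rpow_mul hpos.le, hq1]
  have e3 : ∫ x, G x * (starRingEnd ℂ) (g x) ∂μ = ((N ^ p : ℝ) : ℂ) := by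
    simp_rw [e1]; rw [integral_complex_ofReal, hN, nrm_rpow p hp0]
  have e4 : nrm q g = N ^ (p - 1) := by
    unfold nrm; simp_rw [e2]; rw [← nrm_rpow p hp0, ← hN, ← Real.rpow_mul hN0]; congr 1
    have := hpq.sub_one_mul_conj
    field_simp; linarith
  have key : N ^ p ≤ A * N ^ (p - 1) := by
    apply le_of_forall_pos_le_add
    intro η hη
    set ε := η / (A + N + 1) with hε
    have hε0 : 0 < ε := by positivity
    obtain ⟨d, hd⟩ := weier hgc hgp hε0
    have hdb : BM (fun x => g x - tp d x) := hgb.sub (BM.tp d)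
    have hsm : nrm q (fun x => g x - tp d x) ≤ ε := nrm_le_of_bound hq0 hdb hε0.le hd
    have hd1 : nrm q (tp d) ≤ N ^ (p - 1) + ε := by
      have h1 : tp d = fun x => g x - (g x - tp d x) := by ext x; ring
      rw [h1, ← e4]
      exact (nrm_sub_le hq hgb hdb).trans (by linarith)
    have hi : ∀ F : ℝ → ℂ, Continuous F → Integrable F μ := fun F hF =>
      (hF.integrableOn_Icc (a := 0) (b := 1)).mono_set Set.Ioc_subset_Icc_self
    have hsplit : ∫ x, G x * (starRingEnd ℂ) (g x) ∂μ = ∫ x, G x * (starRingEnd ℂ) (tp d x) ∂μ + ∫ x, G x * (starRingEnd ℂ) (g x - tp d x) ∂μ := by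
      rw [← integral_add]
      · congr 1; ext x; rw [map_sub]; ring
      · exact hi _ (hc.mul (Complex.continuous_conj.comp (cont_tp d)))
      · exact hi _ (hc.mul (Complex.continuous_conj.comp (hgc.sub (cont_tp d))))
    have h5 : N ^ p ≤ A * (N ^ (p - 1) + ε) + N * ε := by
      have : N ^ p = ‖∫ x, G x * (starRingEnd ℂ) (g x) ∂μ‖ := by
        rw [e3, Complex.norm_real, Real.norm_eq_abs, abs_of_nonneg (by positivity)]
      rw [this, hsplit]
      refine (norm_add_le _ _).trans (add_le_add ((h d).trans (by gcongr)) ((holder hpq hGb hdb).trans ?_))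
      gcongr
    have h6 : (A + N + 1) * ε = η := by rw [hε]; field_simp
    nlinarith
  rcases hN0.eq_or_lt with h0 | h0
  · rw [← h0]; exact hA
  · have : N ^ p = N * N ^ (p - 1) := by
      rw [← Real.rpow_one_add' hN0 (by linarith)]; congr 1; ring
    rw [this] at key
    exact le_of_mul_le_mul_right key (Real.rpow_pos_of_pos h0 _)

lemma integral_pos_adj (c d : ℤ →₀ ℂ) :
    ∫ x, tp (pos c) x * (starRingEnd ℂ) (tp d x) ∂μ = ∫ x, tp c x * (starRingEnd ℂ) (tp (pos d) x) ∂μ := by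
  rw [integral_tp_conj, integral_tp_conj]
  have hs : (pos c).support ⊆ c.support := by intro l; simp [pos]
  rw [Finset.sum_subset hs (fun l _ hl => by simp only [Finsupp.mem_support_iff, not_not] at hl; rw [hl, zero_mul])]
  refine sum_congr rfl fun l _ => ?_
  simp only [pos, mul_apply]
  split_ifs <;> simp

theorem riesz {p : ℝ} (hp : 1 < p) : ∃ C : ℝ, 0 < C ∧ ∀ c : ℤ →₀ ℂ, nrm p (tp (pos c)) ≤ C * nrm p (tp c) := by
  rcases le_total p 2 with h2 | h2
  · exact riesz_le_two hp h2
  · have hpq := Real.HolderConjugate.conjExponent hp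
    set q := p.conjExponent
    have hq2 : q ≤ 2 := by
      have := hpq.sub_one_mul_conj
      have := hpq.symm.pos
      by_contra hh; push Not at hh
      have := hpq.inv_add_inv_eq_one
      have h3 : p⁻¹ ≤ 2⁻¹ := by gcongr
      have h4 : q⁻¹ < 2⁻¹ := by gcongr
      linarith
    obtain ⟨C, hC, h⟩ := riesz_le_two hpq.symm.lt hq2
    refine ⟨C, hC, fun c => dual hpq (cont_tp _) (tp_per _) (mul_nonneg hC.le (nrm_nonneg _ _)) fun d => ?_⟩
    rw [integral_pos_adj]
    refine (holder hpq (BM.tp c) (BM.tp _)).trans ?_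
    have := mul_le_mul_of_nonneg_left (h d) (nrm_nonneg p (tp c))
    linarith

/-- frequency modulation -/
noncomputable def md (k : ℤ) (c : ℤ →₀ ℂ) : ℤ →₀ ℂ := Finsupp.equivMapDomain (Equiv.addRight k) c
@[simp] lemma md_apply (k : ℤ) (c : ℤ →₀ ℂ) (l : ℤ) : md k c l = c (l - k) := by
  simp [md, sub_eq_add_neg]
lemma tp_md (k : ℤ) (c : ℤ →₀ ℂ) (x : ℝ) : tp (md k c) x = e k x * tp c x := by
  unfold tp md; rw [Finsupp.sum_equivMapDomain, Finsupp.mul_sum]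
  apply Finsupp.sum_congr; intro l _
  simp [e_add]; ring
lemma nrm_md (p : ℝ) (k : ℤ) (c : ℤ →₀ ℂ) : nrm p (tp (md k c)) = nrm p (tp c) :=
  nrm_congr_norm fun x => by rw [tp_md, norm_mul, norm_e, one_mul]

/-- projection to frequencies in `[a,b]` -/
noncomputable def pr (a b : ℤ) (c : ℤ →₀ ℂ) : ℤ →₀ ℂ := mul (fun l => if a ≤ l ∧ l ≤ b then 1 else 0) c

lemma pr_bound {p : ℝ} (hp : 1 < p) : ∃ C : ℝ, 0 < C ∧ ∀ (a b : ℤ) (c : ℤ →₀ ℂ), nrm p (tp (pr a b c)) ≤ C * nrm p (tp c) := by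
  obtain ⟨C, hC, h⟩ := riesz hp
  refine ⟨2 * C, by positivity, fun a b c => ?_⟩
  have h1 : ∀ a, nrm p (tp (md a (pos (md (-a) c)))) ≤ C * nrm p (tp c) := by
    intro a; rw [nrm_md]; refine (h _).trans ?_; rw [nrm_md]
  by_cases hab : a ≤ b + 1
  · have : pr a b c = md a (pos (md (-a) c)) - md (b+1) (pos (md (-(b+1)) c)) := by
      ext l
      simp only [pr, mul_apply, Finsupp.coe_sub, Pi.sub_apply, md_apply, pos, sub_neg_eq_add, sub_add_cancel]
      by_cases h1 : a ≤ l
      · by_cases h2 : l ≤ b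
        · rw [if_pos ⟨h1, h2⟩, if_pos (by omega), if_neg (by omega)]; ring
        · rw [if_neg (by tauto), if_pos (by omega), if_pos (by omega)]; ring
      · rw [if_neg (by tauto), if_neg (by omega), if_neg (by omega)]; ring
    rw [this]
    refine (nrm_tp_sub hp _ _).trans ?_
    have := h1 a; have := h1 (b+1); linarith
  · have : pr a b c = 0 := by
      ext l; simp only [pr, mul_apply]; rw [if_neg (by omega)]; simp
    rw [this]
    have h0 : tp (0 : ℤ →₀ ℂ) = fun _ => 0 := by ext x; exact tp_zero x
    rw [h0, nrm_zero hp]; exact mul_nonneg (by positivity) (nrm_nonneg _ _)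

lemma bv_bound {p : ℝ} (hp : 1 < p) : ∃ C : ℝ, 0 < C ∧ ∀ (a : ℤ) (k : ℕ) (d : ℤ → ℝ) (c : ℤ →₀ ℂ),
    nrm p (tp (mul (fun l => if a ≤ l ∧ l ≤ a + k then (d l : ℂ) else 0) c)) ≤
      C * (|d a| + ∑ j ∈ range k, |d (a + (j + 1 : ℕ)) - d (a + j)|) * nrm p (tp c) := by
  obtain ⟨C, hC, h⟩ := pr_bound hp
  refine ⟨C, hC, fun a k d c => ?_⟩
  have hid : mul (fun l => if a ≤ l ∧ l ≤ a + k then (d l : ℂ) else 0) c =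
      (d a : ℂ) • pr a (a + k) c + ∑ j ∈ range k, ((d (a + (j + 1 : ℕ)) - d (a + j) : ℝ) : ℂ) • pr (a + (j + 1 : ℕ)) (a + k) c := by
    ext l
    simp only [mul_apply, pr, Finsupp.coe_add, Finsupp.coe_smul, Pi.add_apply, Pi.smul_apply, Finsupp.finsetSum_apply, smul_eq_mul]
    by_cases hl : a ≤ l ∧ l ≤ a + k
    · obtain ⟨i, rfl⟩ : ∃ i : ℕ, l = a + i := ⟨(l - a).toNat, by omega⟩
      have hi : i ≤ k := by omega
      rw [if_pos hl, if_pos hl]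
      have h1 : ∑ j ∈ range k, ((d (a + (j + 1 : ℕ)) - d (a + j) : ℝ) : ℂ) * ((if a + ((j + 1 : ℕ) : ℤ) ≤ a + i ∧ a + (i:ℤ) ≤ a + k then 1 else 0) * c (a + i)) =
          ∑ j ∈ range i, ((d (a + (j + 1 : ℕ)) - d (a + j) : ℝ) : ℂ) * c (a + i) := by
        rw [← Finset.sum_subset (Finset.range_mono hi)]
        · refine sum_congr rfl fun j hj => ?_
          rw [mem_range] at hj
          rw [if_pos (by omega), one_mul]
        · intro j _ hj
          rw [mem_range] at hj
          rw [if_neg (by omega)]; ring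
      rw [h1, ← Finset.sum_mul, ← Complex.ofReal_sum, Finset.sum_range_sub (fun j : ℕ => d (a + j))]
      push_cast; simp; ring
    · rw [if_neg hl, if_neg hl]
      rw [Finset.sum_eq_zero]
      · ring
      · intro j hj; rw [if_neg (by omega)]; ring
  rw [hid]
  refine (nrm_tp_add hp _ _).trans ?_
  have h2 : nrm p (tp (∑ j ∈ range k, ((d (a + (j + 1 : ℕ)) - d (a + j) : ℝ) : ℂ) • pr (a + (j + 1 : ℕ)) (a + k) c)) ≤
      ∑ j ∈ range k, |d (a + (j + 1 : ℕ)) - d (a + j)| * (C * nrm p (tp c)) := by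
    have h3 : tp (∑ j ∈ range k, ((d (a + (j + 1 : ℕ)) - d (a + j) : ℝ) : ℂ) • pr (a + (j + 1 : ℕ)) (a + k) c) =
      fun x => ∑ j ∈ range k, tp (((d (a + (j + 1 : ℕ)) - d (a + j) : ℝ) : ℂ) • pr (a + (j + 1 : ℕ)) (a + k) c) x := by
      ext x; rw [tp_sum]
    rw [h3]
    refine (nrm_sum_le hp fun j _ => BM.tp _).trans (sum_le_sum fun j _ => ?_)
    rw [nrm_tp_smul hp, Complex.norm_real, Real.norm_eq_abs]
    gcongr; exact h _ _ _
  rw [nrm_tp_smul hp, Complex.norm_real, Real.norm_eq_abs]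
  rw [← Finset.sum_mul] at h2
  have h4 := mul_le_mul_of_nonneg_left (h a (a+k) c) (abs_nonneg (d a))
  nlinarith

/-- multipliers `d(|l|)` with `d` monotone or antitone on `[a, b]`, `1 ≤ a` -/
lemma mono_bound {p : ℝ} (hp : 1 < p) : ∃ C : ℝ, 0 < C ∧ ∀ (a b : ℕ) (d : ℕ → ℝ) (B : ℝ), 1 ≤ a → 0 ≤ B →
    (∀ j, a ≤ j → j ≤ b → |d j| ≤ B) →
    ((∀ j, a ≤ j → j + 1 ≤ b → d j ≤ d (j + 1)) ∨ (∀ j, a ≤ j → j + 1 ≤ b → d (j + 1) ≤ d j)) →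
    ∀ c : ℤ →₀ ℂ,
    nrm p (tp (mul (fun l => if a ≤ l.natAbs ∧ l.natAbs ≤ b then (d l.natAbs : ℂ) else 0) c)) ≤ C * B * nrm p (tp c) := by
  obtain ⟨C, hC, h⟩ := bv_bound hp
  refine ⟨6 * C, by positivity, fun a b d B ha hB0 hB hmon c => ?_⟩
  by_cases hab : a ≤ b
  swap
  · have : mul (fun l => if a ≤ l.natAbs ∧ l.natAbs ≤ b then (d l.natAbs : ℂ) else 0) c = 0 := by
      ext l; simp only [mul_apply]; rw [if_neg (by omega)]; simp
    rw [this]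
    have h0 : tp (0 : ℤ →₀ ℂ) = fun _ => 0 := by ext x; exact tp_zero x
    rw [h0, nrm_zero hp]; exact mul_nonneg (by positivity) (nrm_nonneg _ _)
  obtain ⟨k, rfl⟩ := Nat.exists_eq_add_of_le hab
  have tel : ∀ D : ℕ → ℝ, (∀ j, j ≤ k → |D j| ≤ B) → ((∀ j, j + 1 ≤ k → D j ≤ D (j+1)) ∨ (∀ j, j + 1 ≤ k → D (j+1) ≤ D j)) →
      |D 0| + ∑ j ∈ range k, |D (j + 1) - D j| ≤ 3 * B := by
    intro D hD hm
    have h0 := hD 0 (by omega)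
    have hk := abs_le.1 (hD k le_rfl)
    have h0' := abs_le.1 h0
    rcases hm with hm | hm
    · have : ∑ j ∈ range k, |D (j + 1) - D j| = ∑ j ∈ range k, (D (j + 1) - D j) :=
        sum_congr rfl fun j hj => abs_of_nonneg (sub_nonneg.2 (hm j (by rw [mem_range] at hj; omega)))
      rw [this, Finset.sum_range_sub]; linarith
    · have : ∑ j ∈ range k, |D (j + 1) - D j| = ∑ j ∈ range k, -(D (j + 1) - D j) :=
        sum_congr rfl fun j hj => abs_of_nonpos (sub_nonpos.2 (hm j (by rw [mem_range] at hj; omega)))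
      rw [this, Finset.sum_neg_distrib, Finset.sum_range_sub]; linarith
  have t1 := tel (fun j => d (a + j)) (fun j hj => hB _ (by omega) (by omega))
    (hmon.imp (fun h j hj => h (a + j) (by omega) (by omega)) (fun h j hj => h (a + j) (by omega) (by omega)))
  have t2 := tel (fun j => d (a + k - j)) (fun j hj => hB _ (by omega) (by omega))
    (hmon.symm.imp (fun h j hj => by
        have := h (a + k - (j + 1)) (by omega) (by omega)
        rwa [show a + k - (j + 1) + 1 = a + k - j by omega] at this) (fun h j hj => by
        have := h (a + k - (j + 1)) (by omega) (by omega)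
        rwa [show a + k - (j + 1) + 1 = a + k - j by omega] at this))
  have b1 := h a k (fun l => d l.natAbs) c
  have b2 := h (-((a + k : ℕ) : ℤ)) k (fun l => d l.natAbs) c
  have s1 : |d (a:ℤ).natAbs| + ∑ j ∈ range k, |d ((a:ℤ) + (j + 1 : ℕ)).natAbs - d ((a:ℤ) + j).natAbs| ≤ 3 * B := by
    convert t1 using 2
    · simp
    · refine sum_congr rfl fun j _ => ?_
      congr 3
  have s2 : |d (-((a + k : ℕ) : ℤ)).natAbs| + ∑ j ∈ range k, |d (-((a + k : ℕ) : ℤ) + (j + 1 : ℕ)).natAbs - d (-((a + k : ℕ) : ℤ) + j).natAbs| ≤ 3 * B := by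
    convert t2 using 2
    · congr 2; simp only [Int.natAbs_neg]; omega
    · refine sum_congr rfl fun j hj => ?_
      rw [mem_range] at hj
      congr 3
      · omega
      · omega
  have hsplit : mul (fun l => if a ≤ l.natAbs ∧ l.natAbs ≤ a + k then (d l.natAbs : ℂ) else 0) c =
     mul (fun l => if (a:ℤ) ≤ l ∧ l ≤ a + k then ((d l.natAbs : ℝ) : ℂ) else 0) c + mul (fun l => if (-((a + k : ℕ) : ℤ)) ≤ l ∧ l ≤ (-((a + k : ℕ) : ℤ)) + k then ((d l.natAbs : ℝ) : ℂ) else 0) c := by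
    ext l
    simp only [mul_apply, Finsupp.coe_add, Pi.add_apply]
    by_cases h1 : (a:ℤ) ≤ l ∧ l ≤ a + k
    · rw [if_pos h1, if_pos (by omega), if_neg (by omega)]; ring
    · by_cases h2 : (-((a + k : ℕ) : ℤ)) ≤ l ∧ l ≤ (-((a + k : ℕ) : ℤ)) + k
      · rw [if_neg h1, if_pos (by omega), if_pos h2]; ring
      · rw [if_neg h1, if_neg (by omega), if_neg h2]; ring
  rw [hsplit]
  refine (nrm_tp_add hp _ _).trans ?_
  have n0 := nrm_nonneg p (tp c)
  have c1 := mul_le_mul_of_nonneg_right (mul_le_mul_of_nonneg_left s1 hC.le) n0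
  have c2 := mul_le_mul_of_nonneg_right (mul_le_mul_of_nonneg_left s2 hC.le) n0
  linarith
end MZ

namespace MZ

/-- Steklov average with step `1/N` -/
noncomputable def stk (N : ℕ) (F : ℝ → ℂ) (x : ℝ) : ℂ :=
  (N : ℂ) * ∫ t in (-(1 / (2 * (N : ℝ))))..(1 / (2 * (N : ℝ))), F (x + t)

noncomputable def dn (p : ℝ) (N : ℕ) (F : ℝ → ℂ) : ℝ :=
  ((1 / (N : ℝ)) * ∑ k ∈ range N, ‖F ((k : ℝ) / N)‖ ^ p) ^ (1 / p)

lemma stk_e (N : ℕ) (hN : 1 ≤ N) (l : ℤ) (x : ℝ) : stk N (e l) x = (Real.sinc (Real.pi * l / N) : ℂ) * e l x := by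
  unfold stk
  have hN0 : (N : ℝ) ≠ 0 := by positivity
  have hN1 : (N : ℂ) ≠ 0 := by exact_mod_cast (by omega : N ≠ 0)
  simp_rw [e_add_arg]
  rw [intervalIntegral.integral_const_mul]
  by_cases hl : l = 0
  · subst hl; simp [e_zero]
    rw [show (2:ℂ)⁻¹ = 1/2 by norm_num]
    field_simp
    norm_num
  · have hl1 : (l : ℂ) ≠ 0 := by exact_mod_cast hl
    have hl2 : (l : ℝ) ≠ 0 := by exact_mod_cast hl
    have hc : (2 * Real.pi * Complex.I * l : ℂ) ≠ 0 := by
      simp [hl, Real.pi_ne_zero]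
    unfold e
    rw [integral_exp_mul_complex hc]
    have hs : Real.sinc (Real.pi * l / N) = Real.sin (Real.pi * l / N) / (Real.pi * l / N) := by
      rw [Real.sinc_of_ne_zero]; have := Real.pi_ne_zero; positivity
    rw [hs]
    push_cast
    rw [Complex.sin]
    have h1 : (2 * Real.pi * Complex.I * l * (1 / (2 * N)) : ℂ) = Real.pi * l / N * Complex.I := by field_simp
    have h2 : (2 * Real.pi * Complex.I * l * (-(1 / (2 * N))) : ℂ) = - (Real.pi * l / N) * Complex.I := by field_simp
    rw [h1, h2]
    have hpi : (Real.pi : ℂ) ≠ 0 := by exact_mod_cast Real.pi_ne_zero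
    field_simp
    rw [Complex.I_sq]; ring

lemma stk_tp (N : ℕ) (hN : 1 ≤ N) (c : ℤ →₀ ℂ) (x : ℝ) :
    stk N (tp c) x = tp (mul (fun l => (Real.sinc (Real.pi * l / N) : ℂ)) c) x := by
  rw [tp_mul]
  unfold stk tp Finsupp.sum
  rw [intervalIntegral.integral_finsetSum, Finset.mul_sum]
  · refine sum_congr rfl fun l _ => ?_
    rw [intervalIntegral.integral_const_mul]
    have := stk_e N hN l x
    unfold stk at this
    rw [mul_left_comm, this]; ring
  · intro l _
    apply Continuous.intervalIntegrable
    have := cont_e l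
    fun_prop

lemma BM.intervalIntegrable {F : ℝ → ℂ} (hF : BM F) (a b : ℝ) : IntervalIntegrable F volume a b := by
  obtain ⟨M, hM⟩ := hF.bdd
  rw [intervalIntegrable_iff]
  exact Measure.integrableOn_of_bounded (M := M) (by simp) hF.meas.aestronglyMeasurable (Eventually.of_forall hM)

lemma BM.intervalIntegrable_rpow {F : ℝ → ℂ} (hF : BM F) {p : ℝ} (hp : 0 < p) (a b : ℝ) :
    IntervalIntegrable (fun x => ‖F x‖ ^ p) volume a b := by
  obtain ⟨M, hM⟩ := hF.bdd
  rw [intervalIntegrable_iff]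
  refine Measure.integrableOn_of_bounded (M := M ^ p) (by simp) (hF.meas.norm.pow_const p).aestronglyMeasurable (Eventually.of_forall fun x => ?_)
  rw [Real.norm_eq_abs, abs_of_nonneg (by positivity)]
  exact Real.rpow_le_rpow (norm_nonneg _) (hM x) hp.le

lemma stk_pointwise {p : ℝ} (hp : 1 < p) (N : ℕ) (hN : 1 ≤ N) {F : ℝ → ℂ} (hF : BM F) (x : ℝ) :
    ‖stk N F x‖ ^ p ≤ N * ∫ t in (x - 1 / (2 * (N : ℝ)))..(x + 1 / (2 * (N : ℝ))), ‖F t‖ ^ p := by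
  have hN0 : (0 : ℝ) < N := by positivity
  have hp0 : 0 < p := by linarith
  set a := x - 1 / (2 * (N : ℝ)) with ha
  set b := x + 1 / (2 * (N : ℝ)) with hb
  have hba : b - a = 1 / N := by rw [ha, hb]; field_simp; ring
  have hab : a ≤ b := by have : 0 < 1 / (N : ℝ) := by positivity
                         linarith
  have e1 : stk N F x = N * ∫ t in a..b, F t := by
    unfold stk
    rw [intervalIntegral.integral_comp_add_left]
    congr 2
  have e2 : ‖stk N F x‖ ≤ ⨍ t in Set.Ioc a b, ‖F t‖ := by
    rw [e1, norm_mul, Complex.norm_natCast, setAverage_eq, Real.volume_real_Ioc, hba, max_eq_left (by positivity),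
      one_div, inv_inv, smul_eq_mul, ← intervalIntegral.integral_of_le hab]
    gcongr
    exact intervalIntegral.norm_integral_le_integral_norm hab
  have e3 : (⨍ t in Set.Ioc a b, ‖F t‖) ^ p ≤ ⨍ t in Set.Ioc a b, ‖F t‖ ^ p := by
    refine ConvexOn.map_set_average_le (g := fun y : ℝ => y ^ p) (convexOn_rpow hp.le)
      (Real.continuous_rpow_const hp0.le).continuousOn isClosed_Ici ?_ ?_ (Eventually.of_forall fun t => norm_nonneg _) ?_ ?_
    · rw [Real.volume_Ioc, hba]; simp; omega
    · rw [Real.volume_Ioc]; simp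
    · exact (hF.intervalIntegrable a b).1.norm
    · exact (hF.intervalIntegrable_rpow hp0 a b).1
  calc ‖stk N F x‖ ^ p ≤ (⨍ t in Set.Ioc a b, ‖F t‖) ^ p := Real.rpow_le_rpow (norm_nonneg _) e2 hp0.le
    _ ≤ _ := e3
    _ = _ := by
      rw [setAverage_eq, Real.volume_real_Ioc, hba, max_eq_left (by positivity),
      one_div, inv_inv, smul_eq_mul, ← intervalIntegral.integral_of_le hab]

lemma jensen {p : ℝ} (hp : 1 < p) (N : ℕ) (hN : 1 ≤ N) {F : ℝ → ℂ} (hF : BM F) :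
    dn p N (stk N F) ≤ nrm p F := by
  have hN0 : (0 : ℝ) < N := by positivity
  have hp0 : 0 < p := by linarith
  unfold dn nrm
  apply Real.rpow_le_rpow (by positivity) _ (by positivity)
  set a : ℕ → ℝ := fun k => (k : ℝ) / N - 1 / (2 * (N : ℝ)) with ha
  have h1 : ∀ k ∈ range N, ‖stk N F ((k : ℝ) / N)‖ ^ p ≤ N * ∫ t in (a k)..(a (k + 1)), ‖F t‖ ^ p := by
    intro k _
    convert stk_pointwise hp N hN hF ((k : ℝ) / N) using 3
    simp only [ha]; push_cast; field_simp; ring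
  have h2 := sum_le_sum h1
  rw [← Finset.mul_sum, intervalIntegral.sum_integral_adjacent_intervals
    (fun k _ => hF.intervalIntegrable_rpow hp0 _ _)] at h2
  have hper : Function.Periodic (fun t => ‖F t‖ ^ p) 1 := fun x => by simp only [hF.per x]
  have h3 : a N = a 0 + 1 := by simp only [ha]; field_simp; push_cast; ring
  rw [h3, hper.intervalIntegral_add_eq (a 0) 0, zero_add] at h2
  rw [integral_mu]
  calc _ ≤ 1 / (N : ℝ) * (N * ∫ t in (0:ℝ)..1, ‖F t‖ ^ p) := by gcongr
    _ = _ := by field_simp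

lemma dn_nonneg (p : ℝ) (N : ℕ) (F : ℝ → ℂ) : 0 ≤ dn p N F := by unfold dn; positivity

lemma dn_eq {p : ℝ} (N : ℕ) (F : ℝ → ℂ) :
    dn p N F = (1 / (N : ℝ)) ^ (1 / p) * (∑ k ∈ range N, ‖F ((k : ℝ) / N)‖ ^ p) ^ (1 / p) := by
  unfold dn; rw [Real.mul_rpow (by positivity) (by positivity)]

lemma dn_congr {p : ℝ} {N : ℕ} {F G : ℝ → ℂ} (h : ∀ k ∈ range N, F ((k : ℝ) / N) = G ((k : ℝ) / N)) :
    dn p N F = dn p N G := by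
  unfold dn; rw [sum_congr rfl fun k hk => by rw [h k hk]]

lemma dn_add_le {p : ℝ} (hp : 1 < p) (N : ℕ) (F G : ℝ → ℂ) :
    dn p N (fun x => F x + G x) ≤ dn p N F + dn p N G := by
  rw [dn_eq, dn_eq, dn_eq, ← mul_add]
  refine mul_le_mul_of_nonneg_left ?_ (by positivity)
  have := Real.Lp_add_le (range N) (fun k => ‖F ((k : ℝ) / N)‖) (fun k => ‖G ((k : ℝ) / N)‖) hp.le
  simp only [abs_norm] at this
  refine le_trans ?_ this
  gcongr with k _
  rw [abs_of_nonneg (by positivity)]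
  exact norm_add_le _ _

lemma dn_neg (p : ℝ) (N : ℕ) (F : ℝ → ℂ) : dn p N (fun x => - F x) = dn p N F := by
  unfold dn; simp

lemma dn_sub_le {p : ℝ} (hp : 1 < p) (N : ℕ) (F G : ℝ → ℂ) :
    dn p N (fun x => F x - G x) ≤ dn p N F + dn p N G := by
  simp_rw [sub_eq_add_neg]
  refine (dn_add_le hp N F (fun x => - G x)).trans ?_
  rw [dn_neg]

lemma dn_holder {p q : ℝ} (hpq : p.HolderConjugate q) (N : ℕ) (hN : 1 ≤ N) (F G : ℝ → ℂ) :
    ‖(1 / (N : ℂ)) * ∑ k ∈ range N, F ((k : ℝ) / N) * (starRingEnd ℂ) (G ((k : ℝ) / N))‖ ≤ dn p N F * dn q N G := by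
  have hN0 : (0 : ℝ) < N := by positivity
  rw [dn_eq, dn_eq]
  have h1 := Real.inner_le_Lp_mul_Lq (range N) (fun k => ‖F ((k : ℝ) / N)‖) (fun k => ‖G ((k : ℝ) / N)‖) hpq
  simp only [abs_norm] at h1
  have h2 : (1 / (N : ℝ)) ^ (1 / p) * (1 / (N : ℝ)) ^ (1 / q) = 1 / N := by
    rw [← Real.rpow_add (by positivity), one_div p, one_div q, hpq.inv_add_inv_eq_one, Real.rpow_one]
  rw [mul_mul_mul_comm, h2, norm_mul]
  have h3 : ‖(1 / (N : ℂ))‖ = 1 / N := by simp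
  rw [h3]
  gcongr
  refine le_trans ?_ h1
  refine (norm_sum_le _ _).trans (sum_le_sum fun k _ => ?_)
  simp

end MZ

namespace MZ

lemma sin_chord {x y : ℝ} (hx : 0 ≤ x) (hxy : x ≤ y) (hy : y ≤ Real.pi) : x * Real.sin y ≤ y * Real.sin x := by
  rcases (hx.trans hxy).eq_or_lt with h | h
  · have : x = 0 := by linarith
    subst this; rw [← h]
  have h0 : (0:ℝ) ≤ 1 - x / y := by rw [sub_nonneg, div_le_one h]; exact hxy
  have hz : (0:ℝ) ≤ x / y := by positivity
  have h1 := strictConcaveOn_sin_Icc.concaveOn.2 (show (0:ℝ) ∈ Set.Icc 0 Real.pi from ⟨le_rfl, Real.pi_pos.le⟩)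
    (show y ∈ Set.Icc 0 Real.pi from ⟨h.le, hy⟩) h0 hz (by ring)
  simp only [smul_eq_mul, mul_zero, Real.sin_zero, zero_add] at h1
  rw [div_mul_cancel₀ _ h.ne', div_mul_eq_mul_div, div_le_iff₀ h] at h1
  linarith

lemma sin_div_anti {x y : ℝ} (hx : 0 < x) (hxy : x ≤ y) (hy : y ≤ Real.pi) : Real.sin y / y ≤ Real.sin x / x := by
  rw [div_le_div_iff₀ (by linarith) hx]
  have := sin_chord hx.le hxy hy
  linarith

/-- `(t - sin t)/t^3` is antitone -/
lemma cube_chord {L x : ℝ} (hL : 1 ≤ L) (hx : 0 ≤ x) (hy : L * x ≤ Real.pi) :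
    L * x - Real.sin (L * x) ≤ L ^ 3 * (x - Real.sin x) := by
  have hmono : MonotoneOn (fun t => L ^ 3 * (t - Real.sin t) - (L * t - Real.sin (L * t))) (Set.Icc 0 x) := by
    have hd : ∀ t, HasDerivAt (fun t => L ^ 3 * (t - Real.sin t) - (L * t - Real.sin (L * t)))
        (L ^ 3 * (1 - Real.cos t) - (L * 1 - Real.cos (L * t) * (L * 1))) t := by
      intro t
      have h1 := (Real.hasDerivAt_sin t)
      have h2 := ((hasDerivAt_id t).const_mul L)
      have h3 := h2.sin
      exact (((hasDerivAt_id t).sub h1).const_mul (L ^ 3)).sub (h2.sub h3)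
    apply monotoneOn_of_deriv_nonneg (convex_Icc _ _)
    · exact fun t _ => (hd t).continuousAt.continuousWithinAt
    · exact fun t _ => (hd t).differentiableAt.differentiableWithinAt
    · intro t ht
      rw [interior_Icc] at ht
      rw [(hd t).deriv]
      have h0 : 0 < t := ht.1
      have h1 : L * t ≤ Real.pi := le_trans (by gcongr; exact ht.2.le) hy
      have h2 := sin_chord (x := t / 2) (y := L * t / 2) (by linarith) (by nlinarith) (by have := Real.pi_pos; linarith)
      have h3 : Real.sin (L * t / 2) ≤ L * Real.sin (t / 2) := by
        have : t / 2 * Real.sin (L * t / 2) ≤ t / 2 * (L * Real.sin (t / 2)) := by linarith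
        exact le_of_mul_le_mul_left this (by linarith)
      have h4 : 0 ≤ Real.sin (L * t / 2) := Real.sin_nonneg_of_nonneg_of_le_pi (by positivity) (by have := Real.pi_pos; linarith)
      have c1 : 1 - Real.cos t = 2 * Real.sin (t / 2) ^ 2 := by
        rw [Real.sin_sq_eq_half_sub, show 2 * (t / 2) = t by ring]; ring
      have c2 : 1 - Real.cos (L * t) = 2 * Real.sin (L * t / 2) ^ 2 := by
        rw [Real.sin_sq_eq_half_sub, show 2 * (L * t / 2) = L * t by ring]; ring
      have : L ^ 3 * (1 - Real.cos t) - (L * 1 - Real.cos (L * t) * (L * 1)) = L * (L ^ 2 * (1 - Real.cos t) - (1 - Real.cos (L * t))) := by ring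
      rw [this, c1, c2]
      apply mul_nonneg (by linarith)
      have := pow_le_pow_left₀ h4 h3 2
      nlinarith
  have := hmono ⟨le_rfl, hx⟩ ⟨hx, le_rfl⟩ hx
  simp at this
  linarith

lemma phi_anti {x y : ℝ} (hx : 0 < x) (hxy : x ≤ y) (hy : y ≤ Real.pi) :
    (1 - Real.sin y / y) / y ^ 2 ≤ (1 - Real.sin x / x) / x ^ 2 := by
  have hy0 : 0 < y := by linarith
  have h := cube_chord (L := y / x) (x := x) (by rwa [le_div_iff₀ hx, one_mul]) hx.le (by rwa [div_mul_cancel₀ _ hx.ne'])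
  rw [div_mul_cancel₀ _ hx.ne'] at h
  have e1 : (1 - Real.sin y / y) / y ^ 2 = (y - Real.sin y) / y ^ 3 := by field_simp
  have e2 : (1 - Real.sin x / x) / x ^ 2 = (x - Real.sin x) / x ^ 3 := by field_simp
  rw [e1, e2, div_le_iff₀ (by positivity)]
  calc _ ≤ _ := h
    _ = _ := by field_simp

lemma phi_le_one {x : ℝ} (hx : 0 < x) : (1 - Real.sin x / x) / x ^ 2 ≤ 1 := by
  have e2 : (1 - Real.sin x / x) / x ^ 2 = (x - Real.sin x) / x ^ 3 := by field_simp
  rw [e2, div_le_one (by positivity)]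
  rcases le_total x 1 with h | h
  · have := Real.sin_gt_sub_cube hx
    have h3 : 0 < x ^ 3 := by positivity
    nlinarith
  · have h2 : 2 * x ≤ x ^ 3 + 1 := by nlinarith [sq_nonneg (x - 1), mul_nonneg (sub_nonneg.2 h) (sub_nonneg.2 h)]
    by_cases h4 : x ≤ Real.pi
    · have := Real.sin_nonneg_of_nonneg_of_le_pi hx.le h4
      nlinarith
    · have := Real.pi_gt_three
      have := Real.neg_one_le_sin x
      nlinarith

lemma phi_ge {x : ℝ} (hx : 0 < x) (h : x ≤ Real.pi / 2) : 1 / 16 ≤ (1 - Real.sin x / x) / x ^ 2 := by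
  have hp := Real.pi_gt_three
  have hp4 := Real.pi_le_four
  refine le_trans ?_ (phi_anti hx h (by linarith))
  rw [Real.sin_pi_div_two]
  have e2 : (1 - 1 / (Real.pi / 2)) / (Real.pi / 2) ^ 2 = (Real.pi / 2 - 1) / (Real.pi / 2) ^ 3 := by
    have := Real.pi_pos
    field_simp
  rw [e2, le_div_iff₀ (by positivity)]
  have : (Real.pi / 2) ^ 3 ≤ 2 ^ 3 := pow_le_pow_left₀ (by linarith) (by linarith) 3
  linarith

lemma jordan {x : ℝ} (hx : 0 < x) (h : x ≤ Real.pi / 2) : 1 / 2 ≤ Real.sin x / x := by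
  rw [div_le_div_iff₀ (by norm_num) hx]
  have := Real.mul_le_sin hx.le h
  have h2 : 1 / 2 * x ≤ 2 / Real.pi * x := by
    refine mul_le_mul_of_nonneg_right ?_ hx.le
    rw [div_le_div_iff₀ (by norm_num) Real.pi_pos]
    linarith [Real.pi_le_four]
  linarith

lemma even_abs (g : ℝ → ℝ) (hg : ∀ x, g (-x) = g x) (l : ℤ) : g (l.natAbs : ℝ) = g l := by
  rcases Int.natAbs_eq l with h | h
  · conv_rhs => rw [h]
    simp
  · conv_rhs => rw [h]
    rw [Int.cast_neg, hg]; simp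

def Sup (n : ℕ) (c : ℤ →₀ ℂ) : Prop := ∀ l, c l ≠ 0 → l.natAbs ≤ n

lemma Sup.mul {n : ℕ} {c : ℤ →₀ ℂ} (h : Sup n c) (m : ℤ → ℂ) : Sup n (mul m c) := by
  intro l hl; apply h; intro h0; apply hl; simp [h0]
lemma Sup.sub {n : ℕ} {c d : ℤ →₀ ℂ} (h : Sup n c) (h' : Sup n d) : Sup n (c - d) := by
  intro l hl
  by_contra hh
  apply hl
  have h1 : c l = 0 := by by_contra h2; exact hh (h l h2)
  have h2 : d l = 0 := by by_contra h2; exact hh (h' l h2)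
  simp [h1, h2]
lemma Sup.pr (n : ℕ) (c : ℤ →₀ ℂ) : Sup n (pr (-n) n c) := by
  intro l hl
  simp only [MZ.pr, mul_apply] at hl
  by_contra hh
  apply hl; rw [if_neg (by omega)]; simp

noncomputable def dd (h : ℝ) (F : ℝ → ℂ) (x : ℝ) : ℂ := F (x + 2 * h) - 2 * F (x + h) + F x

lemma nrm_dd (p : ℝ) (h : ℝ) (c : ℤ →₀ ℂ) :
    nrm p (dd h (tp c)) = nrm p (tp (mul (fun l => ((-4 * Real.sin (Real.pi * l * h) ^ 2 : ℝ) : ℂ)) c)) := by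
  rw [← nrm_shift (BM.tp (mul (fun l => ((-4 * Real.sin (Real.pi * l * h) ^ 2 : ℝ) : ℂ)) c)) h]
  congr 1; ext x
  unfold dd
  rw [tp_shift, tp_shift, tp_shift, mul_mul, ← tp_smul, ← tp_sub, ← tp_add]
  congr 1
  ext l
  simp only [Finsupp.coe_add, Finsupp.coe_sub, Finsupp.coe_smul, Pi.add_apply, Pi.sub_apply, Pi.smul_apply, mul_apply, smul_eq_mul]
  have key : e l (2 * h) - 2 * e l h + 1 = e l h * ((-4 * Real.sin (Real.pi * l * h) ^ 2 : ℝ) : ℂ) := by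
    rw [two_mul, e_add_arg]
    have h1 : e l h * e (-l) h = 1 := by rw [← e_add]; simp [e_zero]
    have h2 : e l h + e (-l) h = ((2 - 4 * Real.sin (Real.pi * l * h) ^ 2 : ℝ) : ℂ) := by
      rw [e_cos_sin, e_cos_sin]
      have : 2 * Real.pi * ((-l : ℤ) : ℝ) * h = - (2 * Real.pi * l * h) := by push_cast; ring
      rw [this, Real.cos_neg, Real.sin_neg, Real.sin_sq_eq_half_sub, show 2 * (Real.pi * l * h) = 2 * Real.pi * l * h by ring]
      push_cast; ring
    have h3 : ((-4 * Real.sin (Real.pi * l * h) ^ 2 : ℝ) : ℂ) = e l h + e (-l) h - 2 := by rw [h2]; push_cast; ring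
    rw [h3]; linear_combination (1 - 0) * (- h1)
  linear_combination c l * key

/-- `T_δ - T` -/
noncomputable def sd (N : ℕ) (c : ℤ →₀ ℂ) : ℤ →₀ ℂ := mul (fun l => ((Real.sinc (Real.pi * l / N) - 1 : ℝ) : ℂ)) c

lemma tp_sd (N : ℕ) (hN : 1 ≤ N) (c : ℤ →₀ ℂ) (x : ℝ) : tp (sd N c) x = stk N (tp c) x - tp c x := by
  rw [stk_tp N hN, ← tp_sub]; congr 1; ext l; simp [sd]; ring

lemma sinc_abs (l : ℤ) (hl : l ≠ 0) (N : ℕ) : Real.sinc (Real.pi * l / N) = Real.sinc (Real.pi * l.natAbs / N) := by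
  rw [even_abs (fun x => Real.sinc (Real.pi * x / N)) (fun x => by
    rw [show Real.pi * -x / N = - (Real.pi * x / N) by ring, Real.sinc_neg])]

lemma sin_sq_abs (l : ℤ) (h : ℝ) : Real.sin (Real.pi * l * h) ^ 2 = Real.sin (Real.pi * l.natAbs * h) ^ 2 := by
  rw [even_abs (fun x => Real.sin (Real.pi * x * h) ^ 2) (fun x => by
    rw [show Real.pi * -x * h = - (Real.pi * x * h) by ring, Real.sin_neg]; ring)]

lemma angle {n j : ℕ} (h1 : 1 ≤ j) (hj : j ≤ n) : 0 < Real.pi * j / (2 * n + 1 : ℕ) ∧ Real.pi * j / (2 * n + 1 : ℕ) ≤ Real.pi / 2 := by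
  have hp := Real.pi_pos
  have : (j : ℝ) ≤ n := by exact_mod_cast hj
  have hj0 : (0 : ℝ) < j := by exact_mod_cast h1
  refine ⟨by positivity, ?_⟩
  rw [div_le_div_iff₀ (by positivity) (by norm_num)]
  push_cast
  nlinarith

lemma angle_mono {N j : ℕ} : Real.pi * j / N ≤ Real.pi * (j + 1 : ℕ) / N := by
  have hp := Real.pi_pos
  gcongr; omega

lemma sinc_angle {n j : ℕ} (h1 : 1 ≤ j) (hj : j ≤ n) : Real.sinc (Real.pi * j / (2 * n + 1 : ℕ)) = Real.sin (Real.pi * j / (2 * n + 1 : ℕ)) / (Real.pi * j / (2 * n + 1 : ℕ)) :=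
  Real.sinc_of_ne_zero (angle h1 hj).1.ne'

theorem mz_easy {p : ℝ} (hp : 1 < p) : ∃ C : ℝ, 0 < C ∧ ∀ (n : ℕ) (c : ℤ →₀ ℂ), Sup n c →
    dn p (2 * n + 1) (tp c) ≤ C * nrm p (tp c) := by
  obtain ⟨C1, hC1, H1⟩ := mono_bound hp
  obtain ⟨C2, hC2, H2⟩ := pr_bound hp
  refine ⟨C2 + C1 * 2, by positivity, fun n c hc => ?_⟩
  set N := 2 * n + 1 with hN
  set d : ℕ → ℝ := fun j => (Real.sin (Real.pi * j / N) / (Real.pi * j / N))⁻¹ with hd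
  have hpos : ∀ j, 1 ≤ j → j ≤ n → 1 / 2 ≤ Real.sin (Real.pi * j / N) / (Real.pi * j / N) := fun j h1 h2 =>
    jordan (angle h1 h2).1 (angle h1 h2).2
  have hm := H1 1 n d 2 le_rfl (by norm_num) (fun j h1 h2 => by
      have := hpos j h1 h2
      rw [abs_of_nonneg (by simp only [hd]; rw [inv_nonneg]; linarith)]
      simp only [hd]
      rw [inv_le_comm₀ (by linarith) (by norm_num)]; linarith)
    (Or.inl fun j h1 h2 => by
      have hp2 := hpos (j + 1) (by omega) h2
      simp only [hd]
      apply inv_anti₀ (by linarith)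
      exact sin_div_anti (angle h1 (by omega)).1 angle_mono (by have := (angle (n := n) (j := j+1) (by omega) h2).2; have := Real.pi_pos; linarith)) c
  set m : ℤ →₀ ℂ := mul (fun l => if 1 ≤ l.natAbs ∧ l.natAbs ≤ n then (d l.natAbs : ℂ) else 0) c with hmdef
  have hT : mul (fun l => (Real.sinc (Real.pi * l / N) : ℂ)) (pr 0 0 c + m) = c := by
    ext l
    simp only [mul_apply, Finsupp.coe_add, Pi.add_apply, pr, hmdef]
    by_cases h0 : l = 0
    · subst h0; simp
    · by_cases h1 : l.natAbs ≤ n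
      · rw [if_neg (by omega), if_pos (by omega), sinc_abs l h0, sinc_angle (by omega) h1]
        have := hpos l.natAbs (by omega) h1
        simp only [hd]
        rw [zero_mul, zero_add, ← mul_assoc, ← Complex.ofReal_mul, mul_inv_cancel₀ (by linarith)]; simp
      · have : c l = 0 := by by_contra h2; exact h1 (hc l h2)
        simp [this]
  have hT2 : tp c = stk N (tp (pr 0 0 c + m)) := by
    ext x; rw [stk_tp N (by omega), hT]
  rw [hT2]
  refine (jensen hp N (by omega) (BM.tp _)).trans ?_
  rw [← hT2]
  refine (nrm_tp_add hp _ _).trans ?_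
  have := H2 0 0 c
  linarith

lemma quad_e (N : ℕ) (hN : 1 ≤ N) (l : ℤ) (hl : l.natAbs < N) :
    (1 / (N : ℂ)) * ∑ k ∈ range N, e l ((k : ℝ) / N) = if l = 0 then 1 else 0 := by
  have hN1 : (N : ℂ) ≠ 0 := by exact_mod_cast (by omega : N ≠ 0)
  split_ifs with h
  · subst h; simp [e_zero, hN1]
  · have h1 : ∀ k : ℕ, e l ((k : ℝ) / N) = (e l (1 / N)) ^ k := by
      intro k; unfold e; rw [← Complex.exp_nat_mul]; congr 1; push_cast; field_simp
    simp_rw [h1]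
    have h2 : e l (1 / N) ≠ 1 := by
      unfold e
      rw [Ne, Complex.exp_eq_one_iff]
      rintro ⟨k, hk⟩
      have hpi : (Real.pi : ℂ) ≠ 0 := by exact_mod_cast Real.pi_ne_zero
      have hI := Complex.I_ne_zero
      push_cast at hk
      field_simp at hk
      have hk' : l = N * k := by exact_mod_cast hk
      rw [hk', Int.natAbs_mul, Int.natAbs_natCast] at hl
      have : k ≠ 0 := by rintro rfl; simp at hk'; exact h hk'
      have : 1 ≤ k.natAbs := by omega
      nlinarith
    rw [geom_sum_eq h2, ← h1, div_self (by exact_mod_cast (by omega : N ≠ 0))]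
    have := e_int l 1
    simp at this; rw [this]; simp

lemma quad {n : ℕ} {c d : ℤ →₀ ℂ} (hc : Sup n c) (hd : Sup n d) :
    (1 / ((2 * n + 1 : ℕ) : ℂ)) * ∑ k ∈ range (2 * n + 1), tp c ((k : ℝ) / (2 * n + 1 : ℕ)) * (starRingEnd ℂ) (tp d ((k : ℝ) / (2 * n + 1 : ℕ))) =
      ∑ l ∈ c.support, c l * (starRingEnd ℂ) (d l) := by
  set N := 2 * n + 1 with hN
  have h1 : ∀ x, tp c x * (starRingEnd ℂ) (tp d x) = ∑ l ∈ c.support, ∑ m ∈ d.support, c l * (starRingEnd ℂ) (d m) * e (l - m) x := by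
    intro x
    unfold tp Finsupp.sum
    rw [map_sum, Finset.sum_mul_sum]
    refine sum_congr rfl fun l _ => sum_congr rfl fun m _ => ?_
    rw [map_mul, conj_e, sub_eq_add_neg, e_add]; ring
  simp_rw [h1]
  rw [Finset.sum_comm, Finset.mul_sum]
  refine sum_congr rfl fun l hl => ?_
  rw [Finset.sum_comm, Finset.mul_sum]
  have h2 : ∀ m ∈ d.support, 1 / (N : ℂ) * ∑ k ∈ range N, c l * (starRingEnd ℂ) (d m) * e (l - m) ((k : ℝ) / N) = if m = l then c l * (starRingEnd ℂ) (d m) else 0 := by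
    intro m hm
    rw [← Finset.mul_sum, mul_left_comm, quad_e N (by omega)]
    · simp [sub_eq_zero, eq_comm]
    · have := hc l (by simpa using hl); have := hd m (by simpa using hm); omega
  rw [sum_congr rfl h2, Finset.sum_ite_eq']
  split_ifs with h3
  · rfl
  · simp at h3; simp [h3]

theorem mz_hard {p : ℝ} (hp : 1 < p) : ∃ C : ℝ, 0 < C ∧ ∀ (n : ℕ) (c : ℤ →₀ ℂ), Sup n c →
    nrm p (tp c) ≤ C * dn p (2 * n + 1) (tp c) := by
  have hpq := Real.HolderConjugate.conjExponent hp
  set q := p.conjExponent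
  obtain ⟨C1, hC1, H1⟩ := mz_easy hpq.symm.lt
  obtain ⟨C2, hC2, H2⟩ := pr_bound hpq.symm.lt
  refine ⟨C1 * C2, by positivity, fun n c hc => ?_⟩
  refine dual hpq (cont_tp _) (tp_per _) (mul_nonneg (by positivity) (dn_nonneg _ _ _)) fun d => ?_
  have h1 : ∫ x, tp c x * (starRingEnd ℂ) (tp d x) ∂μ = (1 / ((2 * n + 1 : ℕ) : ℂ)) * ∑ k ∈ range (2 * n + 1), tp c ((k : ℝ) / (2 * n + 1 : ℕ)) * (starRingEnd ℂ) (tp (pr (-n) n d) ((k : ℝ) / (2 * n + 1 : ℕ))) := by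
    rw [quad hc (Sup.pr n d), integral_tp_conj]
    refine sum_congr rfl fun l hl => ?_
    have := hc l (by simpa using hl)
    simp only [pr, mul_apply]; rw [if_pos (by omega), one_mul]
  rw [h1]
  refine (dn_holder hpq _ (by omega) _ _).trans ?_
  have h2 := H1 n _ (Sup.pr n d)
  have h3 := H2 (-n) n d
  have h4 := dn_nonneg p (2 * n + 1) (tp c)
  calc _ ≤ dn p (2 * n + 1) (tp c) * (C1 * (C2 * nrm q (tp d))) := by gcongr; exact h2.trans (by gcongr)
    _ = _ := by ring

end MZ

namespace MZ

theorem R1 {p : ℝ} (hp : 1 < p) : ∃ C : ℝ, 0 < C ∧ ∀ (n : ℕ) (h : ℝ) (c : ℤ →₀ ℂ), 1 ≤ n → 0 < h → h < 1 / n → Sup n c →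
    nrm p (dd h (tp c)) ≤ C * nrm p (tp (sd (2 * n + 1) c)) := by
  obtain ⟨C, hC, H⟩ := mono_bound hp
  refine ⟨C * 36 * (C * 16), by positivity, fun n h c hn hh0 hh hc => ?_⟩
  set N := 2 * n + 1 with hN
  have hn0 : (0 : ℝ) < n := by positivity
  have hN0 : (0 : ℝ) < N := by rw [hN]; positivity
  have hpi := Real.pi_pos
  have hh1 : h * n < 1 := by rwa [lt_div_iff₀ hn0] at hh
  have hNh : N * h ≤ 3 := by
    rw [hN]; push_cast
    have : (1:ℝ) ≤ n := by exact_mod_cast hn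
    nlinarith
  have ang : ∀ j : ℕ, 1 ≤ j → j ≤ n → 0 < Real.pi * j * h ∧ Real.pi * j * h ≤ Real.pi := by
    intro j h1 h2
    have : (j : ℝ) ≤ n := by exact_mod_cast h2
    have : (0 : ℝ) < j := by exact_mod_cast h1
    refine ⟨by positivity, ?_⟩
    have : j * h ≤ 1 := by nlinarith
    nlinarith
  set d1 : ℕ → ℝ := fun j => 4 * (N * h) ^ 2 * (Real.sin (Real.pi * j * h) / (Real.pi * j * h)) ^ 2 with hd1
  set d2 : ℕ → ℝ := fun j => ((1 - Real.sin (Real.pi * j / N) / (Real.pi * j / N)) / (Real.pi * j / N) ^ 2)⁻¹ with hd2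
  have q0 : ∀ j : ℕ, 1 ≤ j → j ≤ n → 0 ≤ Real.sin (Real.pi * j * h) / (Real.pi * j * h) := fun j h1 h2 =>
    div_nonneg (Real.sin_nonneg_of_nonneg_of_le_pi (ang j h1 h2).1.le (ang j h1 h2).2) (ang j h1 h2).1.le
  have q1 : ∀ j : ℕ, 1 ≤ j → j ≤ n → 1 / 16 ≤ (1 - Real.sin (Real.pi * j / N) / (Real.pi * j / N)) / (Real.pi * j / N) ^ 2 := fun j h1 h2 =>
    phi_ge (angle h1 h2).1 (angle h1 h2).2
  have b2 := H 1 n d2 16 le_rfl (by norm_num) (fun j h1 h2 => by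
      have := q1 j h1 h2
      simp only [hd2]
      rw [abs_of_nonneg (by rw [inv_nonneg]; linarith), inv_le_comm₀ (by linarith) (by norm_num)]; linarith)
    (Or.inl fun j h1 h2 => by
      have hp2 := q1 (j + 1) (by omega) h2
      simp only [hd2]
      apply inv_anti₀ (by linarith)
      exact phi_anti (angle h1 (by omega)).1 angle_mono (by have := (angle (n := n) (j := j+1) (by omega) h2).2; linarith)) (sd N c)
  set D := mul (fun l => if 1 ≤ l.natAbs ∧ l.natAbs ≤ n then (d2 l.natAbs : ℂ) else 0) (sd N c) with hD
  have b1 := H 1 n d1 36 le_rfl (by norm_num) (fun j h1 h2 => by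
      have := q0 j h1 h2
      have h3 : Real.sin (Real.pi * j * h) / (Real.pi * j * h) ≤ 1 := by
        rw [div_le_one (ang j h1 h2).1]; exact Real.sin_le (ang j h1 h2).1.le
      simp only [hd1]
      rw [abs_of_nonneg (by positivity)]
      have h4 : (Real.sin (Real.pi * j * h) / (Real.pi * j * h)) ^ 2 ≤ 1 := pow_le_one₀ this h3
      have h5 : (N * h) ^ 2 ≤ 3 ^ 2 := pow_le_pow_left₀ (by positivity) hNh 2
      nlinarith [sq_nonneg (N * h), sq_nonneg (Real.sin (Real.pi * j * h) / (Real.pi * j * h))])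
    (Or.inr fun j h1 h2 => by
      have hp2 := q0 (j + 1) (by omega) h2
      simp only [hd1]
      refine mul_le_mul_of_nonneg_left (pow_le_pow_left₀ hp2 ?_ 2) (by positivity)
      exact sin_div_anti (ang j h1 (by omega)).1 (by gcongr; omega) (ang (j + 1) (by omega) h2).2) D
  have hid : mul (fun l => ((-4 * Real.sin (Real.pi * l * h) ^ 2 : ℝ) : ℂ)) c =
      mul (fun l => if 1 ≤ l.natAbs ∧ l.natAbs ≤ n then (d1 l.natAbs : ℂ) else 0) D := by
    ext l
    simp only [mul_apply, hD, sd]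
    by_cases h0 : l = 0
    · subst h0; simp
    · by_cases h1 : l.natAbs ≤ n
      · have h1' : 1 ≤ l.natAbs := by omega
        rw [if_pos ⟨h1', h1⟩, if_pos ⟨h1', h1⟩, sinc_abs l h0, sinc_angle h1' h1, sin_sq_abs]
        rw [← mul_assoc, ← mul_assoc, ← Complex.ofReal_mul, ← Complex.ofReal_mul]
        congr 2
        have hne := q1 l.natAbs h1' h1
        have ha := ang l.natAbs h1' h1
        have ha2 := (angle h1' h1).1
        simp only [hd1, hd2]
        have hj : (0:ℝ) < l.natAbs := by exact_mod_cast h1'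
        rw [← hN] at *
        set S := Real.sin (Real.pi * l.natAbs / N) / (Real.pi * l.natAbs / N) with hS
        have hS1 : 1 - S ≠ 0 := by
          intro h0; rw [h0] at hne; norm_num at hne
        rw [inv_div]
        field_simp
        ring
      · have : c l = 0 := by by_contra h2; exact h1 (hc l h2)
        simp [this]
  rw [nrm_dd, hid]
  refine b1.trans ?_
  calc _ ≤ C * 36 * (C * 16 * nrm p (tp (sd N c))) := by gcongr
    _ = _ := by ring

theorem R2 {p : ℝ} (hp : 1 < p) : ∃ C : ℝ, 0 < C ∧ ∀ (n : ℕ) (c : ℤ →₀ ℂ), 1 ≤ n → Sup n c →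
    nrm p (tp (sd (2 * n + 1) c)) ≤ C * nrm p (dd (1 / (2 * n + 1 : ℕ)) (tp c)) := by
  obtain ⟨C, hC, H⟩ := mono_bound hp
  refine ⟨C * 1 * (C * 1), by positivity, fun n c hn hc => ?_⟩
  set N := 2 * n + 1 with hN
  have hn0 : (0 : ℝ) < n := by positivity
  have hN0 : (0 : ℝ) < N := by rw [hN]; positivity
  have hpi := Real.pi_pos
  set d1 : ℕ → ℝ := fun j => ((1 - Real.sin (Real.pi * j / N) / (Real.pi * j / N)) / (Real.pi * j / N) ^ 2) with hd1
  set d2 : ℕ → ℝ := fun j => (4 * (Real.sin (Real.pi * j / N) / (Real.pi * j / N)) ^ 2)⁻¹ with hd2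
  have q0 : ∀ j : ℕ, 1 ≤ j → j ≤ n → 1 / 2 ≤ Real.sin (Real.pi * j / N) / (Real.pi * j / N) := fun j h1 h2 =>
    jordan (angle h1 h2).1 (angle h1 h2).2
  have q1 : ∀ j : ℕ, 1 ≤ j → j ≤ n → 1 / 16 ≤ (1 - Real.sin (Real.pi * j / N) / (Real.pi * j / N)) / (Real.pi * j / N) ^ 2 := fun j h1 h2 =>
    phi_ge (angle h1 h2).1 (angle h1 h2).2
  set E := mul (fun l => ((-4 * Real.sin (Real.pi * l * (1 / (N : ℕ))) ^ 2 : ℝ) : ℂ)) c with hE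
  have b2 := H 1 n d2 1 le_rfl (by norm_num) (fun j h1 h2 => by
      have := q0 j h1 h2
      have h4 := pow_le_pow_left₀ (by norm_num) this 2
      simp only [hd2]
      rw [abs_of_nonneg (by positivity)]
      apply inv_le_one_of_one_le₀
      linarith)
    (Or.inl fun j h1 h2 => by
      have hp2 := q0 (j + 1) (by omega) h2
      have hp1 := q0 j (by omega) (by omega)
      simp only [hd2]
      apply inv_anti₀ (mul_pos (by norm_num) (pow_pos (by linarith) 2))
      gcongr 4 * ?_
      apply pow_le_pow_left₀ (by linarith)
      exact sin_div_anti (angle h1 (by omega)).1 angle_mono (by have := (angle (n := n) (j := j+1) (by omega) h2).2; linarith)) E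
  set D := mul (fun l => if 1 ≤ l.natAbs ∧ l.natAbs ≤ n then (d2 l.natAbs : ℂ) else 0) E with hD
  have b1 := H 1 n d1 1 le_rfl (by norm_num) (fun j h1 h2 => by
      have := q1 j h1 h2
      simp only [hd1]
      rw [abs_of_nonneg (by linarith)]
      exact phi_le_one (angle h1 h2).1)
    (Or.inr fun j h1 h2 => by
      simp only [hd1]
      exact phi_anti (angle h1 (by omega)).1 angle_mono (by have := (angle (n := n) (j := j+1) (by omega) h2).2; linarith)) D
  have hid : sd N c =
      mul (fun l => if 1 ≤ l.natAbs ∧ l.natAbs ≤ n then (d1 l.natAbs : ℂ) else 0) D := by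
    ext l
    simp only [mul_apply, hD, sd, hE]
    by_cases h0 : l = 0
    · subst h0; simp
    · by_cases h1 : l.natAbs ≤ n
      · have h1' : 1 ≤ l.natAbs := by omega
        rw [if_pos ⟨h1', h1⟩, if_pos ⟨h1', h1⟩, sinc_abs l h0, sinc_angle h1' h1, sin_sq_abs]
        rw [← mul_assoc, ← mul_assoc, ← Complex.ofReal_mul, ← Complex.ofReal_mul]
        congr 2
        have hne := q0 l.natAbs h1' h1
        have ha2 := (angle h1' h1).1
        simp only [hd1, hd2]
        have hj : (0:ℝ) < l.natAbs := by exact_mod_cast h1'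
        rw [← hN] at *
        rw [show Real.pi * (l.natAbs : ℝ) * (1 / N) = Real.pi * l.natAbs / N by ring]
        set x := Real.pi * l.natAbs / N with hx
        have hs : Real.sin x ≠ 0 := by
          intro h0; rw [h0] at hne; norm_num at hne
        field_simp
        ring
      · have : c l = 0 := by by_contra h2; exact h1 (hc l h2)
        simp [this]
  rw [nrm_dd, ← hE]
  conv_lhs => rw [hid]
  refine b1.trans ?_
  calc _ ≤ C * 1 * (C * 1 * nrm p (tp E)) := by gcongr
    _ = _ := by ring

end MZ

namespace MZ

lemma sin_half_sum (t : ℝ) (K : ℕ) : 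
    2 * Real.sin t * ∑ i ∈ range K, Real.cos (2 * i * t) = Real.sin ((2 * K - 1) * t) + Real.sin t ∧
    2 * Real.sin t * ∑ i ∈ range K, Real.sin (2 * i * t) = Real.cos t - Real.cos ((2 * K - 1) * t) := by
  induction K with
  | zero =>
    constructor
    · simp
    · simp
  | succ K ih =>
    rw [sum_range_succ, sum_range_succ, mul_add, mul_add, ih.1, ih.2]
    have h1 : (2 * ((K + 1 : ℕ) : ℝ) - 1) * t = 2 * K * t + t := by push_cast; ring
    have h2 : (2 * (K : ℝ) - 1) * t = 2 * K * t - t := by ring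
    rw [h1, h2, Real.sin_add, Real.sin_sub, Real.cos_add, Real.cos_sub]
    constructor <;> ring

lemma fejer (t : ℝ) (K : ℕ) :
    Real.sin t ^ 2 * ∑ i ∈ range K, ∑ j ∈ range K, (1 - 2 * Real.sin (((i:ℝ) - j) * t) ^ 2) = Real.sin (K * t) ^ 2 := by
  have h0 : ∑ i ∈ range K, ∑ j ∈ range K, (1 - 2 * Real.sin (((i:ℝ) - j) * t) ^ 2) =
      (∑ i ∈ range K, Real.cos (2 * i * t)) ^ 2 + (∑ i ∈ range K, Real.sin (2 * i * t)) ^ 2 := by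
    rw [sq, sq, Finset.sum_mul_sum, Finset.sum_mul_sum, ← sum_add_distrib]
    refine sum_congr rfl fun i _ => ?_
    rw [← sum_add_distrib]
    refine sum_congr rfl fun j _ => ?_
    rw [← Real.cos_sub, Real.sin_sq_eq_half_sub]
    rw [show 2 * (((i:ℝ) - j) * t) = 2 * i * t - 2 * j * t by ring]; ring
  obtain ⟨h1, h2⟩ := sin_half_sum t K
  set A := ∑ i ∈ range K, Real.cos (2 * i * t)
  set B := ∑ i ∈ range K, Real.sin (2 * i * t)
  have h3 : Real.sin t ^ 2 * (A ^ 2 + B ^ 2) = ((2 * Real.sin t * A) ^ 2 + (2 * Real.sin t * B) ^ 2) / 4 := by ring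
  rw [h0, h3, h1, h2]
  have h4 : (2 * (K:ℝ) - 1) * t = 2 * (K * t) - t := by ring
  rw [h4, Real.sin_sub, Real.cos_sub, Real.cos_two_mul, Real.sin_two_mul]
  have e1 := Real.sin_sq_add_cos_sq t
  have e2 := Real.sin_sq_add_cos_sq (K * t)
  set s := Real.sin t
  set c := Real.cos t
  set S := Real.sin (K * t)
  set k := Real.cos (K * t)
  have e3 : c ^ 2 = 1 - s ^ 2 := by linarith
  have e4 : k ^ 2 = 1 - S ^ 2 := by linarith
  have : ((2 * S * k * c - (2 * k ^ 2 - 1) * s + s) ^ 2 + (c - ((2 * k ^ 2 - 1) * c + 2 * S * k * s)) ^ 2) / 4 = S ^ 2 := by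
    rw [e4]
    have : ((2 * S * k * c - (2 * (1 - S ^ 2) - 1) * s + s) ^ 2 + (c - ((2 * (1 - S ^ 2) - 1) * c + 2 * S * k * s)) ^ 2) / 4 
      = (s ^ 2 + c ^ 2) * (S ^ 2 * k ^ 2 + S ^ 4) := by ring
    rw [this, e3, e4]; ring
  exact this

lemma dd_zero (p : ℝ) (hp : 1 < p) (c : ℤ →₀ ℂ) : nrm p (dd 0 (tp c)) = 0 := by
  have : dd 0 (tp c) = fun _ => 0 := by ext x; unfold dd; simp; ring
  rw [this, nrm_zero hp]

theorem jackson {p : ℝ} (hp : 1 < p) : ∃ C : ℝ, 0 < C ∧ ∀ (n : ℕ) (P : ℤ →₀ ℂ) (W : ℝ), 1 ≤ n → 0 ≤ W →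
    (∀ h : ℝ, 0 < h → h < 1 / n → nrm p (dd h (tp P)) ≤ W) →
    ∃ Q, Sup n Q ∧ nrm p (fun x => tp P x - tp Q x) ≤ C * W := by
  obtain ⟨C, hC, H⟩ := mono_bound hp
  refine ⟨1 + C, by positivity, fun n P W hn hW0 hW => ?_⟩
  set N := 2 * n + 1 with hN
  have hn0 : (0 : ℝ) < n := by positivity
  have hN0 : (0 : ℝ) < N := by rw [hN]; positivity
  have hNn : (1 : ℝ) / N < 1 / n := by
    apply one_div_lt_one_div_of_lt hn0; exact_mod_cast (by omega : n < N)
  have hpi := Real.pi_pos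
  obtain ⟨m, hm⟩ : ∃ m : ℕ, Sup m P := by
    refine ⟨P.support.sup Int.natAbs, fun l hl => Finset.le_sup (f := Int.natAbs) (by simpa using hl)⟩
  set K := 2 * m + 1 with hK
  have hK0 : (0 : ℝ) < K := by rw [hK]; positivity
  set h : ℝ := 1 / (K * N) with hh
  have hKh : K * h = 1 / N := by rw [hh]; field_simp
  have hh0 : 0 < h := by positivity
  set γ : ℤ → ℝ := fun l => (1 / (K : ℝ) ^ 2) * ∑ i ∈ range K, ∑ j ∈ range K, (1 - 2 * Real.sin (((i:ℝ) - j) * (Real.pi * l * h)) ^ 2) with hγ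
  set G := mul (fun l => (γ l : ℂ)) P with hG
  have part1 : nrm p (tp (P - G)) ≤ W := by
    have hid : P - G = ∑ i ∈ range K, ∑ j ∈ range K, ((-1 / (2 * (K:ℝ) ^ 2) : ℝ) : ℂ) • mul (fun l => ((-4 * Real.sin (Real.pi * l * (((i:ℝ) - j) * h)) ^ 2 : ℝ) : ℂ)) P := by
      ext l
      simp only [hG, Finsupp.coe_sub, Pi.sub_apply, mul_apply, Finsupp.finsetSum_apply, Finsupp.coe_smul, Pi.smul_apply, smul_eq_mul]
      have sc : 1 - γ l = ∑ i ∈ range K, ∑ j ∈ range K, (-1 / (2 * (K:ℝ) ^ 2)) * (-4 * Real.sin (Real.pi * l * (((i:ℝ) - j) * h)) ^ 2) := by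
        have e1 : ∀ i j : ℕ, (-1 / (2 * (K:ℝ) ^ 2)) * (-4 * Real.sin (Real.pi * l * (((i:ℝ) - j) * h)) ^ 2) =
            (1 / (K:ℝ)^2) * (1 - (1 - 2 * Real.sin (((i:ℝ) - j) * (Real.pi * l * h)) ^ 2)) := by
          intro i j
          rw [show Real.pi * l * (((i:ℝ) - j) * h) = ((i:ℝ) - j) * (Real.pi * l * h) by ring]
          generalize Real.sin (((i:ℝ) - j) * (Real.pi * l * h)) = s
          field_simp; ring
        simp_rw [e1, ← Finset.mul_sum]
        simp_rw [fun (i : ℕ) => Finset.sum_sub_distrib (s := range K) (fun _ : ℕ => (1:ℝ)) (fun j : ℕ => 1 - 2 * Real.sin (((i:ℝ) - j) * (Real.pi * l * h)) ^ 2)]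
        rw [Finset.sum_sub_distrib, mul_sub]
        simp only [sum_const, card_range, nsmul_eq_mul, mul_one, hγ]
        congr 1
        field_simp
      trans ((1 - γ l : ℝ) : ℂ) * P l
      · push_cast; ring
      · rw [sc, Complex.ofReal_sum, Finset.sum_mul]
        refine sum_congr rfl fun i _ => ?_
        rw [Complex.ofReal_sum, Finset.sum_mul]
        refine sum_congr rfl fun j _ => ?_
        rw [Complex.ofReal_mul, mul_assoc]
    have hterm : ∀ i ∈ range K, ∀ j ∈ range K, nrm p (tp (mul (fun l => ((-4 * Real.sin (Real.pi * l * (((i:ℝ) - j) * h)) ^ 2 : ℝ) : ℂ)) P)) ≤ W := by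
      intro i hi j hj
      rw [mem_range] at hi hj
      have hi' : (i : ℝ) < K := by exact_mod_cast hi
      have hj' : (j : ℝ) < K := by exact_mod_cast hj
      have : (fun l : ℤ => ((-4 * Real.sin (Real.pi * l * (((i:ℝ) - j) * h)) ^ 2 : ℝ) : ℂ)) = fun l : ℤ => ((-4 * Real.sin (Real.pi * l * (|(i:ℝ) - j| * h)) ^ 2 : ℝ) : ℂ) := by
        ext l
        rcases abs_choice ((i:ℝ) - j) with h1 | h1
        · rw [h1]
        · rw [h1, show Real.pi * l * (-((i:ℝ) - j) * h) = - (Real.pi * l * (((i:ℝ) - j) * h)) by ring, Real.sin_neg, neg_sq]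
      rw [this, ← nrm_dd]
      rcases (abs_nonneg ((i:ℝ) - j)).eq_or_lt with h0 | h0
      · rw [← h0, zero_mul, dd_zero p hp]; exact hW0
      · refine hW _ (by positivity) (lt_trans ?_ hNn)
        rw [← hKh]
        gcongr
        rw [abs_lt]; constructor <;> linarith [(Nat.cast_nonneg i : (0:ℝ) ≤ i), (Nat.cast_nonneg j : (0:ℝ) ≤ j)]
    rw [hid]
    have e1 : (tp (∑ i ∈ range K, ∑ j ∈ range K, ((-1 / (2 * (K:ℝ) ^ 2) : ℝ) : ℂ) • mul (fun l => ((-4 * Real.sin (Real.pi * l * (((i:ℝ) - j) * h)) ^ 2 : ℝ) : ℂ)) P)) =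
      fun x => ∑ i ∈ range K, ∑ j ∈ range K, tp (((-1 / (2 * (K:ℝ) ^ 2) : ℝ) : ℂ) • mul (fun l => ((-4 * Real.sin (Real.pi * l * (((i:ℝ) - j) * h)) ^ 2 : ℝ) : ℂ)) P) x := by
      ext x; simp_rw [tp_sum]
    rw [e1]
    refine (nrm_sum_le hp fun i _ => BM.sum fun j _ => BM.tp _).trans ?_
    have : ∀ i ∈ range K, nrm p (fun x => ∑ j ∈ range K, tp (((-1 / (2 * (K:ℝ) ^ 2) : ℝ) : ℂ) • mul (fun l => ((-4 * Real.sin (Real.pi * l * (((i:ℝ) - j) * h)) ^ 2 : ℝ) : ℂ)) P) x) ≤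
        ∑ j ∈ range K, 1 / (2 * (K:ℝ) ^ 2) * W := by
      intro i hi
      refine (nrm_sum_le hp fun j _ => BM.tp _).trans (sum_le_sum fun j hj => ?_)
      rw [nrm_tp_smul hp, Complex.norm_real, Real.norm_eq_abs, neg_div, abs_neg, abs_of_nonneg (by positivity)]
      gcongr; exact hterm i hi j hj
    refine (sum_le_sum this).trans ?_
    simp only [sum_const, card_range, nsmul_eq_mul]
    have : (K:ℝ) * (K * (1 / (2 * (K:ℝ) ^ 2) * W)) = W / 2 := by field_simp
    rw [this]; linarith
  set E := mul (fun l => ((-4 * Real.sin (Real.pi * l * (1 / (N : ℕ))) ^ 2 : ℝ) : ℂ)) P with hE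
  have hEW : nrm p (tp E) ≤ W := by rw [hE, ← nrm_dd]; exact hW _ (by positivity) hNn
  have ang : ∀ j : ℕ, j ≤ m → Real.pi * j * h ≤ Real.pi / 2 := by
    intro j h2
    have h3 : (j : ℝ) ≤ m := by exact_mod_cast h2
    have h4 : (1 : ℝ) ≤ N := by exact_mod_cast (by omega : 1 ≤ N)
    have h5 : (j : ℝ) * h ≤ 1 / 2 := by
      rw [hh, mul_one_div, div_le_div_iff₀ (by positivity) (by norm_num), hK]
      push_cast
      nlinarith [(Nat.cast_nonneg m : (0:ℝ) ≤ m)]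
    nlinarith
  have spos : ∀ j : ℕ, 1 ≤ j → j ≤ m → 0 < Real.sin (Real.pi * j * h) := fun j h1 h2 => by
    have : (0:ℝ) < j := by exact_mod_cast h1
    exact Real.sin_pos_of_pos_of_lt_pi (by positivity) (by have := ang j h2; linarith)
  set d : ℕ → ℝ := fun j => (4 * (K * Real.sin (Real.pi * j * h)) ^ 2)⁻¹ with hd
  have b := H (n + 1) m d 1 (by omega) (by norm_num) (fun j h1 h2 => by
      simp only [hd]
      rw [abs_of_nonneg (by positivity)]
      apply inv_le_one_of_one_le₀
      have h3 := Real.mul_le_sin (x := Real.pi * j * h) (by positivity) (ang j h2)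
      have h4 : 2 / Real.pi * (Real.pi * j * h) = 2 * j * h := by field_simp
      rw [h4] at h3
      have h5 : K * (2 * j * h) = 2 * j / N := by rw [show (K:ℝ) * (2 * j * h) = 2 * j * (K * h) by ring, hKh]; ring
      have h6 : (1 : ℝ) ≤ 2 * j / N := by
        rw [le_div_iff₀ hN0, one_mul, hN]; exact_mod_cast (by omega)
      have h7 : 1 ≤ K * Real.sin (Real.pi * j * h) := h6.trans (h5 ▸ (by gcongr))
      nlinarith)
    (Or.inr fun j h1 h2 => by
      simp only [hd]
      have := spos j (by omega) (by omega)
      apply inv_anti₀ (by positivity)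
      refine mul_le_mul_of_nonneg_left (pow_le_pow_left₀ (by positivity) (mul_le_mul_of_nonneg_left ?_ hK0.le) 2) (by norm_num)
      apply Real.sin_le_sin_of_le_of_le_pi_div_two
      · have : 0 ≤ Real.pi * j * h := by positivity
        linarith
      · exact ang (j + 1) h2
      · gcongr; omega) E
  have part2 : G - pr (-n) n G = - mul (fun l => if n + 1 ≤ l.natAbs ∧ l.natAbs ≤ m then (d l.natAbs : ℂ) else 0) E := by
    ext l
    simp only [Finsupp.coe_sub, Finsupp.coe_neg, Pi.sub_apply, Pi.neg_apply, pr, mul_apply, hG, hE]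
    by_cases h1 : l.natAbs ≤ n
    · rw [if_pos (by omega), if_neg (by omega)]; simp
    · by_cases h2 : l.natAbs ≤ m
      · rw [if_neg (by omega), if_pos (by omega)]
        have : (γ l : ℝ) = - (d l.natAbs * (-4 * Real.sin (Real.pi * l * (1 / (N : ℕ))) ^ 2)) := by
          have hs := (spos l.natAbs (by omega) h2).ne'
          simp only [hd, hγ]
          have hs2 := sin_sq_abs l h
          have hs3 : Real.sin (Real.pi * l * h) ≠ 0 := by
            intro h0; rw [h0, zero_pow two_ne_zero] at hs2; exact hs ((pow_eq_zero_iff two_ne_zero).1 hs2.symm)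
          have hf := fejer (Real.pi * l * h) K
          rw [show K * (Real.pi * l * h) = Real.pi * l * (1 / N) by rw [← hKh]; ring] at hf
          rw [mul_pow, ← hs2, ← hf]
          generalize ∑ i ∈ range K, ∑ j ∈ range K, (1 - 2 * Real.sin (((i:ℝ) - j) * (Real.pi * l * h)) ^ 2) = S
          field_simp
        rw [this]; push_cast; ring
      · have : P l = 0 := by by_contra h3; exact h2 (hm l h3)
        simp [this]
  refine ⟨pr (-n) n G, Sup.pr n G, ?_⟩
  have hfin : (fun x => tp P x - tp (pr (-n) n G) x) = tp ((P - G) + (G - pr (-n) n G)) := by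
    ext x; rw [← tp_sub]; congr 1; abel
  rw [hfin]
  refine (nrm_tp_add hp _ _).trans ?_
  rw [part2]
  have hneg : ∀ c : ℤ →₀ ℂ, nrm p (tp (-c)) = nrm p (tp c) := fun c =>
    nrm_congr_norm fun x => by rw [tp_neg, norm_neg]
  rw [hneg]
  have : C * 1 * nrm p (tp E) ≤ C * W := by rw [mul_one]; gcongr
  linarith

end MZ

namespace MZ

lemma coef_of_fun (n : ℕ) (f : ℝ → ℝ) : ∃ c : ℤ →₀ ℂ, Sup n c ∧ ∀ x, ((lagrange n f x : ℝ) : ℂ) = tp c x := by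
  refine ⟨∑ k ∈ range (2 * n + 1), ((1 / (2 * (n:ℝ) + 1) * f (k / (2 * n + 1)) : ℝ) : ℂ) •
    ∑ l ∈ Finset.Icc (-(n:ℤ)) n, Finsupp.single l (e l (-(k / (2 * n + 1)))), ?_, ?_⟩
  · intro l hl
    by_contra hh
    apply hl
    rw [Finsupp.finsetSum_apply]
    refine sum_eq_zero fun k _ => ?_
    rw [Finsupp.smul_apply, Finsupp.finsetSum_apply, sum_eq_zero, smul_zero]
    intro j hj
    rw [Finset.mem_Icc] at hj
    rw [Finsupp.single_apply, if_neg (by rintro rfl; omega)]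
  · intro x
    rw [tp_sum]
    simp_rw [tp_smul, tp_sum, tp_single, ← e_add_arg]
    unfold lagrange dirichlet
    have hD : ∀ y : ℝ, ((∑ l ∈ Finset.Icc (-(n:ℤ)) n, Real.cos (2 * Real.pi * l * y) : ℝ) : ℂ) = ∑ l ∈ Finset.Icc (-(n:ℤ)) n, e l y := by
      intro y
      simp_rw [e_cos_sin]
      rw [sum_add_distrib, ← Finset.sum_mul, ← Complex.ofReal_sum, ← Complex.ofReal_sum]
      have : ∑ l ∈ Finset.Icc (-(n:ℤ)) n, Real.sin (2 * Real.pi * l * y) = 0 := by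
        have h1 : ∑ l ∈ Finset.Icc (-(n:ℤ)) n, Real.sin (2 * Real.pi * l * y) = ∑ l ∈ Finset.Icc (-(n:ℤ)) n, - Real.sin (2 * Real.pi * l * y) := by
          refine Finset.sum_nbij' (fun l => -l) (fun l => -l) ?_ ?_ ?_ ?_ ?_
          · intro l hl; rw [Finset.mem_Icc] at *; omega
          · intro l hl; rw [Finset.mem_Icc] at *; omega
          · intro l _; simp
          · intro l _; simp
          · intro l _; rw [← Real.sin_neg, Int.cast_neg]; congr 1; ring
        rw [sum_neg_distrib] at h1; linarith
      rw [this]; simp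
    rw [Finset.mul_sum, Complex.ofReal_sum]
    refine sum_congr rfl fun k _ => ?_
    rw [← mul_assoc, Complex.ofReal_mul, hD]
    congr 1
    refine sum_congr rfl fun l _ => ?_
    congr 1; ring

lemma lagrange_node (n : ℕ) (f : ℝ → ℝ) (j : ℕ) (hj : j < 2 * n + 1) :
    lagrange n f ((j : ℝ) / (2 * (n : ℝ) + 1)) = f ((j : ℝ) / (2 * (n : ℝ) + 1)) := by
  unfold lagrange
  have hD : ∀ k ∈ range (2 * n + 1), dirichlet n ((j : ℝ) / (2 * (n : ℝ) + 1) - (k : ℝ) / (2 * (n : ℝ) + 1)) = if k = j then (2 * (n : ℝ) + 1) else 0 := by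
    intro k hk
    rw [mem_range] at hk
    unfold dirichlet
    have hq := quad_e (2 * n + 1) (by omega) ((j : ℤ) - k) (by omega)
    have hN1 : ((2 * n + 1 : ℕ) : ℂ) ≠ 0 := Nat.cast_ne_zero.2 (by omega)
    have h1 : ∑ l ∈ Finset.Icc (-(n:ℤ)) n, e ((j : ℤ) - k) ((l : ℝ) / (2 * n + 1 : ℕ)) =
        e ((j : ℤ) - k) (-(n : ℝ) / (2 * n + 1 : ℕ)) * ∑ i ∈ range (2 * n + 1), e ((j : ℤ) - k) ((i : ℝ) / (2 * n + 1 : ℕ)) := by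
      rw [Finset.mul_sum]
      refine Finset.sum_nbij' (fun l => (l + n).toNat) (fun i => (i : ℤ) - n) ?_ ?_ ?_ ?_ ?_
      · intro l hl; rw [Finset.mem_Icc] at hl; rw [mem_range]; omega
      · intro i hi; rw [mem_range] at hi; rw [Finset.mem_Icc]; omega
      · intro l hl; rw [Finset.mem_Icc] at hl; omega
      · intro i hi; simp
      · intro l hl; rw [Finset.mem_Icc] at hl
        rw [← e_add_arg]; congr 1
        have : (((l + n).toNat : ℕ) : ℝ) = l + n := by
          have h2 : (((l + n).toNat : ℕ) : ℤ) = l + n := by omega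
          exact_mod_cast congrArg (fun z : ℤ => (z : ℝ)) h2
        rw [this]; ring
    have h2 : ∑ l ∈ Finset.Icc (-(n:ℤ)) n, e ((j : ℤ) - k) ((l : ℝ) / (2 * n + 1 : ℕ)) = if k = j then ((2 * (n : ℝ) + 1 : ℝ) : ℂ) else 0 := by
      rw [h1]
      split_ifs with h
      · subst h; simp [e_zero]
      · rw [if_neg (by omega), mul_eq_zero] at hq
        rcases hq with hq | hq
        · simp at hq; exact absurd (by exact_mod_cast hq) hN1
        · rw [hq, mul_zero]
    have h3 := congrArg Complex.re h2
    rw [Complex.re_sum] at h3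
    have h4 : ∀ l : ℤ, (e ((j : ℤ) - k) ((l : ℝ) / (2 * n + 1 : ℕ))).re = Real.cos (2 * Real.pi * l * ((j : ℝ) / (2 * (n : ℝ) + 1) - (k : ℝ) / (2 * (n : ℝ) + 1))) := by
      intro l
      rw [e_cos_sin]
      simp only [Complex.add_re, Complex.ofReal_re, Complex.mul_re, Complex.I_re, Complex.ofReal_im, Complex.I_im, mul_zero, zero_mul, sub_zero, add_zero]
      congr 1; push_cast; ring
    simp_rw [h4] at h3
    rw [h3]; split_ifs <;> simp
  rw [sum_congr rfl fun k hk => by rw [hD k hk]]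
  simp only [mul_ite, mul_zero]
  rw [Finset.sum_ite_eq', if_pos (by rwa [mem_range])]
  field_simp

lemma density {p : ℝ} (hp : 1 < p) {F : ℝ → ℂ} (hF : BM F) {η : ℝ} (hη : 0 < η) :
    ∃ P : ℤ →₀ ℂ, nrm p (fun x => F x - tp P x) ≤ η := by
  have : Fact (0 < (1:ℝ)) := ⟨one_pos⟩
  have hp0 : 0 < p := by linarith
  set q := ENNReal.ofReal p
  obtain ⟨M, hM⟩ := hF.bdd
  set Fb : AddCircle (1:ℝ) → ℂ := fun y => F (AddCircle.measurableEquivIoc 1 0 y : Set.Ioc (0:ℝ) (0+1)) with hFb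
  have hFm : Measurable Fb := hF.meas.comp (measurable_subtype_coe.comp (AddCircle.measurableEquivIoc 1 0).measurable)
  have hFL : MemLp Fb q volume := MemLp.of_bound hFm.aestronglyMeasurable M (Eventually.of_forall fun y => hM _)
  have hε : ENNReal.ofReal (η / 2) ≠ 0 := by simp [hη]
  obtain ⟨g, hg, hgm⟩ := hFL.exists_boundedContinuous_eLpNorm_sub_le ENNReal.ofReal_ne_top hε
  set G : ℝ → ℂ := fun x => g (x : AddCircle (1:ℝ)) with hG
  have hGc : Continuous G := g.continuous.comp (AddCircle.continuous_mk' 1)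
  have hGp : Function.Periodic G 1 := fun x => by
    simp only [hG]; rw [AddCircle.coe_add_period]
  have hGb := BM.of_cont hGc hGp
  obtain ⟨P, hP⟩ := weier hGc hGp (half_pos hη)
  refine ⟨P, ?_⟩
  have h1 : nrm p (fun x => F x - G x) ≤ η / 2 := by
    rw [nrm_eq (hF.sub hGb) hp0]
    apply ENNReal.toReal_le_of_le_ofReal (by linarith)
    refine le_trans (le_of_eq ?_) hg
    have hmp := AddCircle.measurePreserving_mk (1:ℝ) 0
    rw [← eLpNorm_comp_measurePreserving (hFm.aestronglyMeasurable.sub g.continuous.aestronglyMeasurable) hmp, zero_add]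
    apply eLpNorm_congr_ae
    unfold μ
    filter_upwards [ae_restrict_mem measurableSet_Ioc] with x hx
    simp only [Function.comp, Pi.sub_apply, hFb, hG]
    congr 2
    have hx' : x ∈ Set.Ioc (0:ℝ) (0 + 1) := by simpa using hx
    have : AddCircle.measurableEquivIoc 1 0 (x : AddCircle (1:ℝ)) = ⟨x, hx'⟩ := AddCircle.equivIoc_coe_eq hx'
    rw [this]
  have h2 : nrm p (fun x => G x - tp P x) ≤ η / 2 := nrm_le_of_bound hp0 (hGb.sub (BM.tp P)) (by linarith) hP
  have h3 : (fun x => F x - tp P x) = fun x => (F x - G x) + (G x - tp P x) := by ext x; ring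
  rw [h3]
  refine (nrm_add_le hp (hF.sub hGb) (hGb.sub (BM.tp P))).trans ?_
  linarith

end MZ

namespace MZ

lemma BM.ofReal {p : ℝ} {f : ℝ → ℝ} (hf : MemLpT p f) (hb : ∃ M : ℝ, ∀ x, |f x| ≤ M) :
    BM (fun x => (f x : ℂ)) := by
  obtain ⟨M, hM⟩ := hb
  refine ⟨Complex.measurable_ofReal.comp hf.2.1, ⟨M, fun x => by simpa using hM x⟩, fun x => ?_⟩
  show ((f (x + 1) : ℝ) : ℂ) = _
  rw [hf.1 x]

lemma LpNorm_eq (p : ℝ) (g : ℝ → ℝ) : LpNorm p g = nrm p (fun x => (g x : ℂ)) := by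
  simp [LpNorm, nrm, integral_mu]

lemma Delta_eq (h : ℝ) (f : ℝ → ℝ) (x : ℝ) :
    ((Delta 2 h f x : ℝ) : ℂ) = dd h (fun x => (f x : ℂ)) x := by
  have h1 : Delta 2 h f x = f (x + 2 * h) - 2 * f (x + h) + f x := by
    simp only [Delta, Finset.sum_range_succ, Finset.sum_range_zero]
    norm_num
    ring
  rw [h1]; unfold dd; push_cast; rfl

lemma LpDelta (p h : ℝ) (f : ℝ → ℝ) : LpNorm p (Delta 2 h f) = nrm p (dd h (fun x => (f x : ℂ))) := by
  rw [LpNorm_eq]; congr 1; funext x; exact Delta_eq h f x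

lemma steklov_eq (n : ℕ) (f : ℝ → ℝ) (x : ℝ) :
    ((steklov 1 (1 / (2 * (n : ℝ) + 1)) f x : ℝ) : ℂ) = stk (2 * n + 1) (fun x => (f x : ℂ)) x := by
  have hN : (2 * (n : ℝ) + 1) ≠ 0 := by positivity
  have h1 : steklov 1 (1 / (2 * (n : ℝ) + 1)) f x
      = (2 * (n : ℝ) + 1) * ∫ t in (-(1 / (2 * (2 * (n : ℝ) + 1))))..(1 / (2 * (2 * (n : ℝ) + 1))), f (x + t) := by
    have h2 : (1 / (2 * (n : ℝ) + 1)) / 2 = 1 / (2 * (2 * (n : ℝ) + 1)) := by field_simp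
    unfold steklov
    rw [h2]
    simp
  rw [h1]
  unfold stk
  rw [intervalIntegral.integral_ofReal]
  push_cast
  rfl

lemma ellp_eq (p : ℝ) (n : ℕ) (f : ℝ → ℝ) :
    ellp p (2 * n + 1) (fun k => (k : ℝ) / (2 * (n : ℝ) + 1)) (fun x => steklov 1 (1 / (2 * (n : ℝ) + 1)) f x - f x)
      = dn p (2 * n + 1) (fun x => stk (2 * n + 1) (fun x => (f x : ℂ)) x - (f x : ℂ)) := by
  unfold ellp dn
  congr 2
  apply Finset.sum_congr rfl
  intro k _
  dsimp only
  rw [← steklov_eq, ← Complex.ofReal_sub, Complex.norm_real, Real.norm_eq_abs]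
  push_cast
  rfl

lemma BM.dd {F : ℝ → ℂ} (hF : BM F) (h : ℝ) : BM (dd h F) :=
  ((hF.shift (2 * h)).sub ((hF.shift h).const_mul 2)).add hF

lemma nrm_dd_le {p : ℝ} (hp : 1 < p) {F : ℝ → ℂ} (hF : BM F) (h : ℝ) : nrm p (MZ.dd h F) ≤ 4 * nrm p F := by
  have h1 := nrm_add_le hp ((hF.shift (2 * h)).sub ((hF.shift h).const_mul 2)) hF
  have h2 := nrm_sub_le hp (hF.shift (2 * h)) ((hF.shift h).const_mul 2)
  rw [nrm_const_mul hp, nrm_shift hF, nrm_shift hF] at h2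
  have h3 : nrm p (MZ.dd h F) = nrm p (fun x => (F (x + 2 * h) - 2 * F (x + h)) + F x) := rfl
  norm_num at h2
  rw [h3]; linarith

lemma nrm_dd_cmp {p : ℝ} (hp : 1 < p) {F G : ℝ → ℂ} (hF : BM F) (hG : BM G) (h : ℝ) :
    nrm p (MZ.dd h F) ≤ 4 * nrm p (fun x => F x - G x) + nrm p (MZ.dd h G) := by
  have h1 := nrm_add_le hp ((hF.sub hG).dd h) (hG.dd h)
  have h2 := nrm_dd_le hp (hF.sub hG) h
  have h3 : (fun x => MZ.dd h (fun x => F x - G x) x + MZ.dd h G x) = MZ.dd h F := by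
    funext x; unfold MZ.dd; ring
  rw [h3] at h1; linarith

lemma nrm_sub_comm {p : ℝ} (F G : ℝ → ℂ) : nrm p (fun x => F x - G x) = nrm p (fun x => G x - F x) :=
  nrm_congr_norm fun x => norm_sub_rev _ _

lemma stk_sub (N : ℕ) {F G : ℝ → ℂ} (hF : BM F) (hG : BM G) (x : ℝ) :
    stk N (fun x => F x - G x) x = stk N F x - stk N G x := by
  unfold stk
  rw [← mul_sub, ← intervalIntegral.integral_sub]
  · have := (hF.shift x).intervalIntegrable (-(1/(2*(N:ℝ)))) (1/(2*(N:ℝ)))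
    simpa [add_comm] using this
  · have := (hG.shift x).intervalIntegrable (-(1/(2*(N:ℝ)))) (1/(2*(N:ℝ)))
    simpa [add_comm] using this

section omega
variable {p : ℝ} {f : ℝ → ℝ}

lemma omega_bdd (hp : 1 < p) (hF : BM (fun x => (f x : ℂ))) (δ : ℝ) :
    BddAbove {y | ∃ h : ℝ, 0 < h ∧ h < δ ∧ y = LpNorm p (Delta 2 h f)} := by
  refine ⟨4 * nrm p (fun x => (f x : ℂ)), ?_⟩
  rintro y ⟨h, _, _, rfl⟩
  rw [LpDelta]; exact nrm_dd_le hp hF h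

lemma le_omega (hp : 1 < p) (hF : BM (fun x => (f x : ℂ))) {h δ : ℝ} (h0 : 0 < h) (h1 : h < δ) :
    nrm p (MZ.dd h (fun x => (f x : ℂ))) ≤ omegaMod 2 p f δ := by
  apply le_csSup (omega_bdd hp hF δ)
  exact ⟨h, h0, h1, (LpDelta _ _ _).symm⟩

lemma omega_nonneg (hp : 1 < p) (hF : BM (fun x => (f x : ℂ))) {δ : ℝ} (hδ : 0 < δ) : 0 ≤ omegaMod 2 p f δ :=
  (nrm_nonneg _ _).trans (le_omega hp hF (half_pos hδ) (half_lt_self hδ))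

lemma omega_le {δ B : ℝ} (hδ : 0 < δ)
    (h : ∀ h, 0 < h → h < δ → nrm p (MZ.dd h (fun x => (f x : ℂ))) ≤ B) : omegaMod 2 p f δ ≤ B := by
  unfold omegaMod
  refine csSup_le ⟨_, δ / 2, half_pos hδ, half_lt_self hδ, rfl⟩ ?_
  rintro y ⟨t, h0, h1, rfl⟩
  rw [LpDelta]; exact h t h0 h1

end omega

/-- Jackson for bounded measurable functions. -/
lemma jackson_f {p : ℝ} (hp : 1 < p) : ∃ C > 0, ∀ (f : ℝ → ℝ) (n : ℕ) (η : ℝ), BM (fun x => (f x : ℂ)) → 1 ≤ n → 0 < η →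
    ∃ Q, Sup n Q ∧ nrm p (fun x => (f x : ℂ) - tp Q x) ≤ C * (omegaMod 2 p f (1 / (n : ℝ)) + η) := by
  obtain ⟨C, hC, H⟩ := jackson hp
  refine ⟨C + 1, by linarith, fun f n η hF hn hη => ?_⟩
  have hn' : (0:ℝ) < 1 / n := by have : (1:ℝ) ≤ n := by exact_mod_cast hn
                                 positivity
  obtain ⟨P, hP⟩ := density hp hF (η := η / 4) (by linarith)
  have h0 := omega_nonneg hp hF hn'
  obtain ⟨Q, hQ, hQ'⟩ := H n P (omegaMod 2 p f (1 / (n : ℝ)) + η) hn (by linarith) (by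
    intro h h1 h2
    have h3 := nrm_dd_cmp hp (BM.tp P) hF h
    rw [nrm_sub_comm] at h3
    have h4 := le_omega hp hF h1 h2
    linarith)
  refine ⟨Q, hQ, ?_⟩
  have h5 := nrm_add_le hp (hF.sub (BM.tp P)) ((BM.tp P).sub (BM.tp Q))
  simp only [sub_add_sub_cancel] at h5
  nlinarith

set_option maxHeartbeats 1000000 in
lemma key {p : ℝ} (hp : 1 < p) : ∃ C > 0, ∀ (f : ℝ → ℝ) (n : ℕ), BM (fun x => (f x : ℂ)) → 1 ≤ n →
    ∀ E S w : ℝ, E = LpNorm p (fun x => f x - lagrange n f x) →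
      S = ellp p (2 * n + 1) (fun k => (k : ℝ) / (2 * (n : ℝ) + 1)) (fun x => steklov 1 (1 / (2 * (n : ℝ) + 1)) f x - f x) →
      w = omegaMod 2 p f (1 / (n : ℝ)) →
      0 ≤ E ∧ 0 ≤ S ∧ 0 ≤ w ∧ w ≤ C * (E + S) ∧ S ≤ C * (E + w) ∧ E ≤ C * (S + w) := by
  obtain ⟨Ce, hCe, He⟩ := mz_easy hp
  obtain ⟨Ch, hCh, Hh⟩ := mz_hard hp
  obtain ⟨C1, hC1, H1⟩ := R1 hp
  obtain ⟨C2, hC2, H2⟩ := R2 hp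
  obtain ⟨CJ, hCJ, HJ⟩ := jackson_f hp
  set CA := 4 + C1 * Ch with hCA
  set CB := 1 + Ce * (C2 * 4) with hCB
  set CC := CJ + Ch * (1 + CJ + Ce * (C2 * (4 * CJ + 1))) with hCC
  have hCA0 : 0 < CA := by positivity
  have hCB0 : 0 < CB := by positivity
  have hCC0 : 0 < CC := by positivity
  refine ⟨CA + CB + CC, by positivity, fun f n hF hn E S w hE hS hw => ?_⟩
  have hn1 : (1:ℝ) ≤ n := by exact_mod_cast hn
  have hn' : (0:ℝ) < 1 / n := by positivity
  obtain ⟨c, hc, hcx⟩ := coef_of_fun n f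
  have hT := BM.tp c
  have hNn : 1 ≤ 2 * n + 1 := by omega
  set F : ℝ → ℂ := fun x => (f x : ℂ) with hFd
  have hE' : E = nrm p (fun x => F x - tp c x) := by
    rw [hE, LpNorm_eq]; congr 1; funext x; rw [← hcx]; simp [hFd]
  have hS' : S = dn p (2 * n + 1) (fun x => stk (2 * n + 1) F x - F x) := by
    rw [hS, ellp_eq]
  have hnode : ∀ k ∈ range (2 * n + 1), tp c ((k:ℝ) / ((2 * n + 1 : ℕ) : ℝ)) = F ((k:ℝ) / ((2 * n + 1 : ℕ) : ℝ)) := by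
    intro k hk
    have := lagrange_node n f k (Finset.mem_range.1 hk)
    rw [← hcx, hFd]
    push_cast
    rw [this]
  have hE0 : 0 ≤ E := by rw [hE']; exact nrm_nonneg _ _
  have hS0 : 0 ≤ S := by rw [hS']; exact dn_nonneg _ _ _
  have hw0 : 0 ≤ w := by rw [hw]; exact omega_nonneg hp hF hn'
  have hh0 : (0:ℝ) < 1 / ((2 * n + 1 : ℕ) : ℝ) := by positivity
  have hh1 : (1:ℝ) / ((2 * n + 1 : ℕ) : ℝ) < 1 / n := by
    apply one_div_lt_one_div_of_lt (by linarith)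
    push_cast; linarith
  -- discrete norm of the Steklov difference of the interpolant
  set D := dn p (2 * n + 1) (tp (sd (2 * n + 1) c)) with hD
  have hJ : dn p (2 * n + 1) (stk (2 * n + 1) (fun x => F x - tp c x)) ≤ E := by
    rw [hE']; exact jensen hp _ hNn (hF.sub hT)
  have hD1 : D ≤ E + S := by
    have h1 := dn_sub_le hp (2 * n + 1) (fun x => stk (2 * n + 1) F x - F x) (stk (2 * n + 1) (fun x => F x - tp c x))
    have h2 : D = dn p (2 * n + 1) (fun x => (stk (2 * n + 1) F x - F x) - stk (2 * n + 1) (fun x => F x - tp c x) x) := by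
      apply dn_congr
      intro k hk
      rw [tp_sd _ hNn, stk_sub _ hF hT, hnode k hk]; ring
    rw [h2]; linarith
  have hD2 : S ≤ E + D := by
    have h1 := dn_add_le hp (2 * n + 1) (tp (sd (2 * n + 1) c)) (stk (2 * n + 1) (fun x => F x - tp c x))
    have h2 : S = dn p (2 * n + 1) (fun x => tp (sd (2 * n + 1) c) x + stk (2 * n + 1) (fun x => F x - tp c x) x) := by
      rw [hS']
      apply dn_congr
      intro k hk
      rw [tp_sd _ hNn, stk_sub _ hF hT, hnode k hk]; ring
    rw [h2]; linarith
  have hA : w ≤ CA * (E + S) := by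
    rw [hw]
    apply omega_le hn'
    intro h h0 h1
    have a1 := nrm_dd_cmp hp hF hT h
    rw [← hE'] at a1
    have a2 := H1 n h c hn h0 h1 hc
    have a3 := Hh n (sd (2 * n + 1) c) (hc.mul _)
    have a4 : C1 * nrm p (tp (sd (2 * n + 1) c)) ≤ C1 * (Ch * (E + S)) := by
      gcongr
      exact a3.trans (by gcongr)
    have : nrm p (MZ.dd h F) ≤ 4 * E + C1 * (Ch * (E + S)) := by linarith
    rw [hCA]; nlinarith
  have hB : S ≤ CB * (E + w) := by
    have a1 := nrm_dd_cmp hp hT hF (1 / ((2 * n + 1 : ℕ) : ℝ))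
    rw [nrm_sub_comm, ← hE'] at a1
    have a2 := le_omega hp hF hh0 hh1
    rw [← hw] at a2
    have a3 := H2 n c hn hc
    have a4 := He n (sd (2 * n + 1) c) (hc.mul _)
    have a5 : nrm p (tp (sd (2 * n + 1) c)) ≤ C2 * (4 * (E + w)) := by
      refine a3.trans ?_
      gcongr
      refine a1.trans ?_
      linarith
    have a6 : D ≤ Ce * (C2 * (4 * (E + w))) := a4.trans (by gcongr)
    rw [hCB]; nlinarith
  have hC : E ≤ CC * (S + w) := by
    apply le_of_forall_pos_le_add
    intro ε hε
    set η := ε / CC with hη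
    have hη0 : 0 < η := by positivity
    obtain ⟨Q, hQ, hQ1⟩ := HJ f n η hF hn hη0
    rw [← hw] at hQ1
    have hTQ := BM.tp Q
    set q := nrm p (fun x => F x - tp Q x) with hq
    have a1 := nrm_dd_cmp hp hTQ hF (1 / ((2 * n + 1 : ℕ) : ℝ))
    rw [nrm_sub_comm] at a1
    change nrm p (MZ.dd _ (tp Q)) ≤ 4 * q + _ at a1
    have a2 := le_omega hp hF hh0 hh1
    rw [← hw] at a2
    have a3 := H2 n Q hn hQ
    have a4 := He n (sd (2 * n + 1) Q) (hQ.mul _)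
    have a5 : nrm p (tp (sd (2 * n + 1) Q)) ≤ C2 * ((4 * CJ + 1) * (w + η)) := by
      refine a3.trans ?_
      gcongr
      refine a1.trans ?_
      nlinarith
    have a6 : dn p (2 * n + 1) (tp (sd (2 * n + 1) Q)) ≤ Ce * (C2 * ((4 * CJ + 1) * (w + η))) := a4.trans (by gcongr)
    have a7 : dn p (2 * n + 1) (stk (2 * n + 1) (fun x => F x - tp Q x)) ≤ q := jensen hp _ hNn (hF.sub hTQ)
    have a8 : dn p (2 * n + 1) (tp (c - Q)) ≤ S + q + dn p (2 * n + 1) (tp (sd (2 * n + 1) Q)) := by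
      have b1 := dn_add_le hp (2 * n + 1) (fun x => stk (2 * n + 1) (fun x => F x - tp Q x) x + tp (sd (2 * n + 1) Q) x)
        (fun x => - (stk (2 * n + 1) F x - F x))
      have b2 := dn_add_le hp (2 * n + 1) (stk (2 * n + 1) (fun x => F x - tp Q x)) (tp (sd (2 * n + 1) Q))
      rw [dn_neg, ← hS'] at b1
      have b3 : dn p (2 * n + 1) (tp (c - Q)) = dn p (2 * n + 1) (fun x => (stk (2 * n + 1) (fun x => F x - tp Q x) x + tp (sd (2 * n + 1) Q) x) + (- (stk (2 * n + 1) F x - F x))) := by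
        apply dn_congr
        intro k hk
        rw [tp_sd _ hNn, stk_sub _ hF hTQ, tp_sub, hnode k hk]; ring
      rw [b3]; linarith
    have a9 := Hh n _ (hc.sub hQ)
    have a10 : E ≤ q + nrm p (tp (c - Q)) := by
      have b1 := nrm_sub_le hp (hF.sub hTQ) (BM.tp (c - Q))
      rw [hE']
      refine le_trans (le_of_eq ?_) b1
      congr 1; funext x; rw [tp_sub]; ring
    have a11 : dn p (2 * n + 1) (tp (c - Q)) ≤ (1 + CJ + Ce * (C2 * (4 * CJ + 1))) * (S + w + η) := by
      have : 0 ≤ (CJ + Ce * (C2 * (4 * CJ + 1))) * S := by positivity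
      have h0 : 0 ≤ w + η := by positivity
      linarith
    have a12 : nrm p (tp (c - Q)) ≤ Ch * ((1 + CJ + Ce * (C2 * (4 * CJ + 1))) * (S + w + η)) := a9.trans (by gcongr)
    have a13 : E ≤ CC * (S + w + η) := by
      have : 0 ≤ CJ * S := by positivity
      rw [hCC]; linarith
    have : CC * η = ε := by rw [hη]; field_simp
    linarith
  refine ⟨hE0, hS0, hw0, hA.trans ?_, hB.trans ?_, hC.trans ?_⟩
  · gcongr; linarith
  · gcongr; linarith
  · gcongr; linarith

end MZ


theorem stmt18 (p : ℝ) (hp : 1 < p) (f : ℝ → ℝ) (hf : MemLpT p f)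
    (hbdd : ∃ M : ℝ, ∀ x, |f x| ≤ M) :
    ((∀ ε : ℝ, 0 < ε → ∃ N : ℕ, ∀ n : ℕ, N ≤ n → omegaMod 2 p f (1 / (n : ℝ)) ≤ ε * ellp p (2 * n + 1) (fun k => (k : ℝ) / (2 * (n : ℝ) + 1)) (fun x => steklov 1 (1 / (2 * (n : ℝ) + 1)) f x - f x)) →
      ∃ c C : ℝ, ∃ N : ℕ, 0 < c ∧ 0 < C ∧ ∀ n : ℕ, N ≤ n →
        c * ellp p (2 * n + 1) (fun k => (k : ℝ) / (2 * (n : ℝ) + 1)) (fun x => steklov 1 (1 / (2 * (n : ℝ) + 1)) f x - f x) ≤ LpNorm p (fun x => f x - lagrange n f x) ∧ LpNorm p (fun x => f x - lagrange n f x) ≤ C * ellp p (2 * n + 1) (fun k => (k : ℝ) / (2 * (n : ℝ) + 1)) (fun x => steklov 1 (1 / (2 * (n : ℝ) + 1)) f x - f x)) ∧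
    ((∀ ε : ℝ, 0 < ε → ∃ N : ℕ, ∀ n : ℕ, N ≤ n → ellp p (2 * n + 1) (fun k => (k : ℝ) / (2 * (n : ℝ) + 1)) (fun x => steklov 1 (1 / (2 * (n : ℝ) + 1)) f x - f x) ≤ ε * omegaMod 2 p f (1 / (n : ℝ))) →
      ∃ c C : ℝ, ∃ N : ℕ, 0 < c ∧ 0 < C ∧ ∀ n : ℕ, N ≤ n →
        c * omegaMod 2 p f (1 / (n : ℝ)) ≤ LpNorm p (fun x => f x - lagrange n f x) ∧ LpNorm p (fun x => f x - lagrange n f x) ≤ C * omegaMod 2 p f (1 / (n : ℝ))) := by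

  have hF := MZ.BM.ofReal hf hbdd
  obtain ⟨C, hC, K⟩ := MZ.key hp
  have hε : 0 < 1 / (2 * C) := by positivity
  have hc : 0 < 1 / (2 * C) := hε
  constructor
  · intro H
    obtain ⟨N1, H1⟩ := H 1 one_pos
    obtain ⟨N2, H2⟩ := H _ hε
    refine ⟨1 / (2 * C), 2 * C, N1 + N2 + 1, hc, by positivity, fun n hn => ?_⟩
    obtain ⟨hE, hS, hw, -, hB, hCC⟩ := K f n hF (by omega) _ _ _ rfl rfl rfl
    have h1 := H1 n (by omega)
    have h2 := H2 n (by omega)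
    revert hE hS hw hB hCC h1 h2
    generalize LpNorm p (fun x => f x - lagrange n f x) = E
    generalize ellp p (2 * n + 1) (fun k => (k : ℝ) / (2 * (n : ℝ) + 1)) (fun x => steklov 1 (1 / (2 * (n : ℝ) + 1)) f x - f x) = S
    generalize omegaMod 2 p f (1 / (n : ℝ)) = w
    intro hE hS hw hB hCC h1 h2
    constructor
    · rw [one_div_mul_eq_div] at h2 ⊢
      rw [le_div_iff₀ (by positivity)] at h2
      rw [div_le_iff₀ (by positivity)]
      linarith
    · nlinarith
  · intro H
    obtain ⟨N1, H1⟩ := H 1 one_pos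
    obtain ⟨N2, H2⟩ := H _ hε
    refine ⟨1 / (2 * C), 2 * C, N1 + N2 + 1, hc, by positivity, fun n hn => ?_⟩
    obtain ⟨hE, hS, hw, hA, -, hCC⟩ := K f n hF (by omega) _ _ _ rfl rfl rfl
    have h1 := H1 n (by omega)
    have h2 := H2 n (by omega)
    revert hE hS hw hA hCC h1 h2
    generalize LpNorm p (fun x => f x - lagrange n f x) = E
    generalize ellp p (2 * n + 1) (fun k => (k : ℝ) / (2 * (n : ℝ) + 1)) (fun x => steklov 1 (1 / (2 * (n : ℝ) + 1)) f x - f x) = S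
    generalize omegaMod 2 p f (1 / (n : ℝ)) = w
    intro hE hS hw hA hCC h1 h2
    constructor
    · rw [one_div_mul_eq_div] at h2 ⊢
      rw [le_div_iff₀ (by positivity)] at h2
      rw [div_le_iff₀ (by positivity)]
      linarith
    · nlinarith
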